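/- arXiv:1004.2756 — 2 statements merged into one kernel-verified Lean document; each statement's English description precedes it below -/
import Mathlib

section
/- Let p ∈ [1, ∞) and let N be an integer with N > n/p. Then there is a constant C such that for every sufficiently smooth function φ on ℝ^{1+n} for which the right-hand side is finite, |φ(t,x)| ≤ C(1+t+|x|)^{−(n−1)/p} (1+|t−|x||)^{−1/p} Σ_{|I| ≤ N} ‖Z^I φ(t,·)‖_{L^p(ℝⁿ)} for all t ≥ 0 and x ∈ ℝⁿ. -/
open MeasureTheory Real NNReal ENNReal

noncomputable section

/-- Partial derivative in the `i`-th coordinate direction. -/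
def pd {n : ℕ} (i : Fin n) (f : (Fin n → ℝ) → ℝ) : (Fin n → ℝ) → ℝ :=
  fun y => fderiv ℝ f y (Pi.single i 1)

/-- Euclidean norm on `ℝⁿ`. -/
def rnorm {n : ℕ} (x : Fin n → ℝ) : ℝ := Real.sqrt (∑ i, x i ^ 2)

/-- Laplacian. -/
def lap {n : ℕ} (g : (Fin n → ℝ) → ℝ) : (Fin n → ℝ) → ℝ := fun x => ∑ i, pd i (pd i g) x

/-- time derivative of a time-dependent function -/
def dt {α : Type*} (u : ℝ → α → ℝ) : ℝ → α → ℝ := fun t x => deriv (fun s => u s x) t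

/-- Wave operator on spacetime `ℝ^{1+n}` (coordinate `0` is time). -/
def waveOp {n : ℕ} (f : (Fin (n+1) → ℝ) → ℝ) : (Fin (n+1) → ℝ) → ℝ :=
  fun y => pd 0 (pd 0 f) y - ∑ i : Fin n, pd i.succ (pd i.succ f) y

/-- Index type for the Klainerman vector fields: coordinate derivatives `∂_i`,
the scaling field `L₀`, rotations `Ω_{ij}` (`1 ≤ i < j ≤ n`), and boosts `Ω_{0i}`. -/
abbrev VFIdx (n : ℕ) := (Fin (n+1)) ⊕ (Unit ⊕ (({p : Fin n × Fin n // p.1 < p.2}) ⊕ Fin n))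

/-- The Klainerman vector fields, acting on functions on spacetime `ℝ^{1+n}`. -/
def vf {n : ℕ} : VFIdx n → ((Fin (n+1) → ℝ) → ℝ) → (Fin (n+1) → ℝ) → ℝ
  | Sum.inl i => fun f y => pd i f y
  | Sum.inr (Sum.inl _) => fun f y => ∑ i, y i * pd i f y
  | Sum.inr (Sum.inr (Sum.inl p)) => fun f y =>
      y p.1.1.succ * pd p.1.2.succ f y - y p.1.2.succ * pd p.1.1.succ f y
  | Sum.inr (Sum.inr (Sum.inr i)) => fun f y => y 0 * pd i.succ f y + y i.succ * pd 0 f y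

/-- `Z^I`: composition of the Klainerman vector fields indexed by the word `I`. -/
def Zpow {n l : ℕ} (I : Fin l → VFIdx n) (f : (Fin (n+1) → ℝ) → ℝ) :
    (Fin (n+1) → ℝ) → ℝ :=
  (List.ofFn I).foldr vf f

/-- `L^p` norm of the time-`t` slice of a spacetime function. -/
def sliceNorm {n : ℕ} (f : (Fin (n+1) → ℝ) → ℝ) (t : ℝ) (p : ℝ≥0∞) : ℝ≥0∞ :=
  eLpNorm (fun x : Fin n → ℝ => f (Fin.cons t x)) p volume


/-- Families of functions on `[0,1]` with `k` uniformly bounded derivatives. -/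
def BD {ι : Type} : ℕ → (ι → ℝ → ℝ) → Prop
  | 0, c => (∃ M : ℝ, ∀ i, ∀ s ∈ Set.Icc (0:ℝ) 1, |c i s| ≤ M) ∧
      ∀ i, ContinuousOn (c i) (Set.Icc 0 1)
  | k+1, c => (∃ M : ℝ, ∀ i, ∀ s ∈ Set.Icc (0:ℝ) 1, |c i s| ≤ M) ∧
      ∃ c' : ι → ℝ → ℝ, (∀ i, ∀ s ∈ Set.Icc (0:ℝ) 1, HasDerivAt (c i) (c' i s) s) ∧ BD k c'

lemma BD.bdd {ι : Type} {k : ℕ} {c : ι → ℝ → ℝ} (h : BD k c) :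
    ∃ M : ℝ, ∀ i, ∀ s ∈ Set.Icc (0:ℝ) 1, |c i s| ≤ M := by
  cases k with
  | zero => exact h.1
  | succ k => exact h.1

lemma BD.cont {ι : Type} {k : ℕ} {c : ι → ℝ → ℝ} (h : BD k c) (i : ι) :
    ContinuousOn (c i) (Set.Icc 0 1) := by
  cases k with
  | zero => exact h.2 i
  | succ k =>
    obtain ⟨_, c', hc, _⟩ := h
    intro s hs
    exact (hc i s hs).continuousAt.continuousWithinAt

lemma BD.down {ι : Type} {k : ℕ} {c : ι → ℝ → ℝ} (h : BD (k+1) c) : BD k c := by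
  induction k generalizing c with
  | zero => exact ⟨h.bdd, h.cont⟩
  | succ k ih =>
    obtain ⟨hb, c', hc, h'⟩ := h
    exact ⟨hb, c', hc, ih h'⟩

lemma BD.congr {ι : Type} {k : ℕ} {c d : ι → ℝ → ℝ} (h : BD k c) (e : ∀ i s, d i s = c i s) :
    BD k d := by
  have : d = c := by funext i s; exact e i s
  rwa [this]

lemma BD.const {ι : Type} (k : ℕ) {a : ι → ℝ} {M : ℝ} (h : ∀ i, |a i| ≤ M) :
    BD k (fun i _ => a i) := by
  induction k generalizing a M with
  | zero => exact ⟨⟨M, fun i _ _ => h i⟩, fun i => continuousOn_const⟩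
  | succ k ih =>
    exact ⟨⟨M, fun i _ _ => h i⟩, fun _ _ => 0, fun i s _ => hasDerivAt_const s (a i),
      ih (a := fun _ => 0) (M := 0) (by simp)⟩

lemma BD.cst {ι : Type} (k : ℕ) (a : ℝ) : BD k (fun (_ : ι) _ => a) :=
  BD.const k (a := fun _ => a) (M := |a|) (fun _ => le_rfl)

lemma BD.id {ι : Type} (k : ℕ) : BD k (fun (_ : ι) s => s) := by
  have hb : ∃ M : ℝ, ∀ _ : ι, ∀ s ∈ Set.Icc (0:ℝ) 1, |s| ≤ M :=
    ⟨1, fun _ s hs => by rw [abs_of_nonneg hs.1]; exact hs.2⟩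
  cases k with
  | zero => exact ⟨hb, fun i => continuousOn_id⟩
  | succ k => exact ⟨hb, fun _ _ => 1, fun i s _ => hasDerivAt_id' s, BD.cst k 1⟩

lemma BD.add {ι : Type} {k : ℕ} {c d : ι → ℝ → ℝ} (h : BD k c) (g : BD k d) :
    BD k (fun i s => c i s + d i s) := by
  have hb : ∃ M : ℝ, ∀ i, ∀ s ∈ Set.Icc (0:ℝ) 1, |c i s + d i s| ≤ M := by
    obtain ⟨M, hM⟩ := h.bdd
    obtain ⟨M', hM'⟩ := g.bdd
    exact ⟨M + M', fun i s hs => (abs_add_le _ _).trans (add_le_add (hM i s hs) (hM' i s hs))⟩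
  induction k generalizing c d with
  | zero => exact ⟨hb, fun i => (h.2 i).add (g.2 i)⟩
  | succ k ih =>
    obtain ⟨_, c', hc, h'⟩ := h
    obtain ⟨_, d', hd, g'⟩ := g
    refine ⟨hb, fun i s => c' i s + d' i s, fun i s hs => (hc i s hs).add (hd i s hs),
      ih h' g' ?_⟩
    obtain ⟨M, hM⟩ := h'.bdd
    obtain ⟨M', hM'⟩ := g'.bdd
    exact ⟨M + M', fun i s hs => (abs_add_le _ _).trans (add_le_add (hM i s hs) (hM' i s hs))⟩

lemma BD.mul_bdd {ι : Type} {k : ℕ} {c d : ι → ℝ → ℝ} (h : BD k c) (g : BD k d) :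
    ∃ M : ℝ, ∀ i, ∀ s ∈ Set.Icc (0:ℝ) 1, |c i s * d i s| ≤ M := by
  obtain ⟨M, hM⟩ := h.bdd
  obtain ⟨M', hM'⟩ := g.bdd
  refine ⟨M * M', fun i s hs => ?_⟩
  rw [abs_mul]
  exact mul_le_mul (hM i s hs) (hM' i s hs) (abs_nonneg _) ((abs_nonneg _).trans (hM i s hs))

lemma BD.mul {ι : Type} {k : ℕ} {c d : ι → ℝ → ℝ} (h : BD k c) (g : BD k d) :
    BD k (fun i s => c i s * d i s) := by
  have hb := h.mul_bdd g
  induction k generalizing c d with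
  | zero => exact ⟨hb, fun i => (h.2 i).mul (g.2 i)⟩
  | succ k ih =>
    have h0 := h.down
    have g0 := g.down
    obtain ⟨_, c', hc, h'⟩ := h
    obtain ⟨_, d', hd, g'⟩ := g
    exact ⟨hb, fun i s => c' i s * d i s + c i s * d' i s,
      fun i s hs => (hc i s hs).mul (hd i s hs),
      (ih h' g0 (h'.mul_bdd g0)).add (ih h0 g' (h0.mul_bdd g'))⟩

lemma BD.neg {ι : Type} {k : ℕ} {c : ι → ℝ → ℝ} (h : BD k c) : BD k (fun i s => -c i s) :=
  ((BD.cst k (-1)).mul h).congr (fun i s => by ring)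

lemma BD.sub {ι : Type} {k : ℕ} {c d : ι → ℝ → ℝ} (h : BD k c) (g : BD k d) :
    BD k (fun i s => c i s - d i s) :=
  (h.add g.neg).congr (fun i s => by ring)

lemma BD.sum {ι : Type} {k : ℕ} {α : Type*} (A : Finset α) {c : α → ι → ℝ → ℝ}
    (h : ∀ a, BD k (c a)) : BD k (fun i s => ∑ a ∈ A, c a i s) := by
  classical
  induction A using Finset.induction_on with
  | empty => simpa using BD.cst k 0
  | insert a A ha ih =>
    exact ((h a).add ih).congr (fun i s => by rw [Finset.sum_insert ha])

lemma BD.inv {ι : Type} {k : ℕ} {c : ι → ℝ → ℝ} (h : BD k c) {m : ℝ} (hm : 0 < m)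
    (hc : ∀ i, ∀ s ∈ Set.Icc (0:ℝ) 1, m ≤ |c i s|) : BD k (fun i s => (c i s)⁻¹) := by
  have hb : ∃ M : ℝ, ∀ i, ∀ s ∈ Set.Icc (0:ℝ) 1, |(c i s)⁻¹| ≤ M :=
    ⟨m⁻¹, fun i s hs => by rw [abs_inv]; exact inv_anti₀ hm (hc i s hs)⟩
  have hne : ∀ i, ∀ s ∈ Set.Icc (0:ℝ) 1, c i s ≠ 0 := fun i s hs h0 => by
    have := hc i s hs
    rw [h0, abs_zero] at this
    linarith
  induction k with
  | zero => exact ⟨hb, fun i => (h.2 i).inv₀ (hne i)⟩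
  | succ k ih =>
    have hi := ih h.down
    obtain ⟨_, c', hc', h'⟩ := h
    refine ⟨hb, fun i s => -(c' i s) * ((c i s)⁻¹ * (c i s)⁻¹), fun i s hs => ?_,
      h'.neg.mul (hi.mul hi)⟩
    have := (hc' i s hs).inv (hne i s hs)
    refine HasDerivAt.congr_deriv (f := fun s => (c i s)⁻¹) this ?_
    show -c' i s / c i s ^ 2 = -(c' i s) * ((c i s)⁻¹ * (c i s)⁻¹)
    rw [div_eq_mul_inv (-c' i s), sq, mul_inv]

lemma BD.sqrt {ι : Type} {k : ℕ} {c : ι → ℝ → ℝ} (h : BD k c) {m : ℝ} (hm : 0 < m)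
    (hc : ∀ i, ∀ s ∈ Set.Icc (0:ℝ) 1, m ≤ c i s) : BD k (fun i s => √(c i s)) := by
  have hb : ∃ M : ℝ, ∀ i, ∀ s ∈ Set.Icc (0:ℝ) 1, |√(c i s)| ≤ M := by
    obtain ⟨M, hM⟩ := h.bdd
    refine ⟨√M, fun i s hs => ?_⟩
    rw [abs_of_nonneg (Real.sqrt_nonneg _)]
    exact Real.sqrt_le_sqrt ((le_abs_self _).trans (hM i s hs))
  induction k with
  | zero => exact ⟨hb, fun i => (h.2 i).sqrt⟩
  | succ k ih =>
    have hi := ih h.down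
    have hi' := hi.inv (m := √m) (Real.sqrt_pos.2 hm) (fun i s hs => by
      rw [abs_of_nonneg (Real.sqrt_nonneg _)]
      exact Real.sqrt_le_sqrt (hc i s hs))
    obtain ⟨_, c', hc', h'⟩ := h
    refine ⟨hb, fun i s => (1/2) * c' i s * (√(c i s))⁻¹, fun i s hs => ?_,
      ((BD.cst k (1/2)).mul h').mul hi'⟩
    have hp : 0 < c i s := hm.trans_le (hc i s hs)
    have := (hc' i s hs).sqrt hp.ne'
    convert this using 1
    show (1/2) * c' i s * (√(c i s))⁻¹ = c' i s / (2 * √(c i s))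
    rw [div_eq_mul_inv (c' i s), mul_inv]
    ring

lemma step_ibp (m : ℕ) (P : Polynomial ℝ) (G G' : ℝ → ℝ)
    (hG : ∀ s ∈ Set.Icc (0:ℝ) 1, HasDerivAt G (G' s) s) (hG' : ContinuousOn G' (Set.Icc 0 1)) :
    ∫ s in (0:ℝ)..1, s^m * (P.eval s * G s) =
      ∫ s in (0:ℝ)..1, s^(m+1) *
        ((Polynomial.C ((m+1:ℝ)⁻¹) * (Polynomial.C ((m+2) * P.eval 1) - P.derivative)).eval s * G s
        + (Polynomial.C ((m+1:ℝ)⁻¹) * (Polynomial.X * Polynomial.C (P.eval 1) - P)).eval s * G' s) := by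
  have hGc : ContinuousOn G (Set.Icc 0 1) := fun s hs => (hG s hs).continuousAt.continuousWithinAt
  have hm : (m+1:ℝ) ≠ 0 := by positivity
  have key : ∫ s in (0:ℝ)..1, (s^(m+1) *
        ((Polynomial.C ((m+1:ℝ)⁻¹) * (Polynomial.C ((m+2) * P.eval 1) - P.derivative)).eval s * G s
        + (Polynomial.C ((m+1:ℝ)⁻¹) * (Polynomial.X * Polynomial.C (P.eval 1) - P)).eval s * G' s)
        - s^m * (P.eval s * G s)) = 0 := by
    have h := intervalIntegral.integral_eq_sub_of_hasDerivAt (a := (0:ℝ)) (b := 1)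
      (f := fun s => s^(m+1) * ((m+1:ℝ)⁻¹ * (s * P.eval 1 - P.eval s)) * G s)
      (f' := fun s => (s^(m+1) *
        ((Polynomial.C ((m+1:ℝ)⁻¹) * (Polynomial.C ((m+2) * P.eval 1) - P.derivative)).eval s * G s
        + (Polynomial.C ((m+1:ℝ)⁻¹) * (Polynomial.X * Polynomial.C (P.eval 1) - P)).eval s * G' s)
        - s^m * (P.eval s * G s))) ?_ ?_
    · rw [h]; simp
    · intro s hs
      rw [Set.uIcc_of_le zero_le_one] at hs
      have h1 := ((((hasDerivAt_pow (m+1) s).mul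
        ((((hasDerivAt_id' s).mul_const (P.eval 1)).sub (P.hasDerivAt s)).const_mul ((m+1:ℝ)⁻¹))).mul
        (hG s hs)))
      refine h1.congr_deriv ?_
      simp only [Polynomial.eval_mul, Polynomial.eval_C, Polynomial.eval_sub, Polynomial.eval_X,
        Pi.mul_apply, Pi.sub_apply, Nat.add_sub_cancel]
      push_cast
      field_simp
      ring
    · apply ContinuousOn.intervalIntegrable
      rw [Set.uIcc_of_le zero_le_one]
      fun_prop
  rw [intervalIntegral.integral_sub] at key
  · linarith
  all_goals
    apply ContinuousOn.intervalIntegrable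
    rw [Set.uIcc_of_le zero_le_one]
    fun_prop

lemma taylor_signed (m : ℕ) : ∃ P : ℕ → Polynomial ℝ, ∀ F : ℕ → ℝ → ℝ,
    (∀ k < m + 1, ∀ s ∈ Set.Icc (0:ℝ) 1, HasDerivAt (F k) (F (k+1) s) s) →
    ContinuousOn (F (m+1)) (Set.Icc 0 1) →
    F 0 0 = ∑ k ∈ Finset.range (m+2), ∫ s in (0:ℝ)..1, s^m * ((P k).eval s * F k s) := by
  induction m with
  | zero =>
    refine ⟨fun k => if k = 0 then 1 else Polynomial.X - 1, fun F hF hc => ?_⟩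
    have hF0 := hF 0 (by norm_num)
    have hGc : ContinuousOn (F 0) (Set.Icc 0 1) :=
      fun s hs => (hF0 s hs).continuousAt.continuousWithinAt
    have h := intervalIntegral.integral_eq_sub_of_hasDerivAt (a := (0:ℝ)) (b := 1)
      (f := fun s => (s - 1) * F 0 s) (f' := fun s => F 0 s + (s-1) * F 1 s) ?_ ?_
    · rw [intervalIntegral.integral_add] at h
      · simp [Finset.sum_range_succ]
        simp at h
        linarith
      all_goals
        apply ContinuousOn.intervalIntegrable
        rw [Set.uIcc_of_le zero_le_one]
        fun_prop
    · intro s hs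
      rw [Set.uIcc_of_le zero_le_one] at hs
      refine (((hasDerivAt_id' s).sub_const 1).mul (hF0 s hs)).congr_deriv ?_
      simp
    · apply ContinuousOn.intervalIntegrable
      rw [Set.uIcc_of_le zero_le_one]
      fun_prop
  | succ m ih =>
    obtain ⟨P, hP⟩ := ih
    set Q : ℕ → Polynomial ℝ := fun k =>
      Polynomial.C ((m+1:ℝ)⁻¹) * (Polynomial.C ((m+2) * (P k).eval 1) - (P k).derivative) with hQ
    set R : ℕ → Polynomial ℝ := fun k =>
      Polynomial.C ((m+1:ℝ)⁻¹) * (Polynomial.X * Polynomial.C ((P k).eval 1) - P k) with hR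
    refine ⟨fun k => (if k < m + 2 then Q k else 0) + (if k = 0 then 0 else R (k-1)),
      fun F hF hc => ?_⟩
    have hcont : ∀ k < m + 3, ContinuousOn (F k) (Set.Icc 0 1) := by
      intro k hk
      rcases Nat.lt_or_ge k (m+2) with h | h
      · exact fun s hs => (hF k (by omega) s hs).continuousAt.continuousWithinAt
      · have : k = m + 1 + 1 := by omega
        rw [this]; exact hc
    rw [hP F (fun k hk => hF k (by omega)) (hcont _ (by omega))]
    have h1 : ∀ k ∈ Finset.range (m+2), ∫ s in (0:ℝ)..1, s^m * ((P k).eval s * F k s) =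
        (∫ s in (0:ℝ)..1, s^(m+1) * ((Q k).eval s * F k s)) +
        ∫ s in (0:ℝ)..1, s^(m+1) * ((R k).eval s * F (k+1) s) := by
      intro k hk
      have hk := Finset.mem_range.1 hk
      have c1 := hcont k (by omega)
      have c2 := hcont (k+1) (by omega)
      rw [step_ibp m (P k) (F k) (F (k+1)) (hF k (by omega)) c2,
        ← intervalIntegral.integral_add]
      · simp only [mul_add]
        rfl
      all_goals
        apply ContinuousOn.intervalIntegrable
        rw [Set.uIcc_of_le zero_le_one]
        fun_prop
    rw [Finset.sum_congr rfl h1, Finset.sum_add_distrib]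
    have h2 : ∀ k ∈ Finset.range (m+1+2), ∫ s in (0:ℝ)..1, s^(m+1) *
        (((if k < m + 2 then Q k else 0) + (if k = 0 then 0 else R (k-1))).eval s * F k s) =
        (∫ s in (0:ℝ)..1, s^(m+1) * ((if k < m + 2 then Q k else 0).eval s * F k s)) +
        ∫ s in (0:ℝ)..1, s^(m+1) * ((if k = 0 then 0 else R (k-1)).eval s * F k s) := by
      intro k hk
      have hk := Finset.mem_range.1 hk
      have c1 := hcont k (by omega)
      rw [← intervalIntegral.integral_add]
      · simp only [Polynomial.eval_add, add_mul, mul_add]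
      all_goals
        apply ContinuousOn.intervalIntegrable
        rw [Set.uIcc_of_le zero_le_one]
        fun_prop
    rw [Finset.sum_congr rfl h2, Finset.sum_add_distrib]
    congr 1
    · rw [Finset.sum_range_succ _ (m+2)]
      simp only [lt_irrefl, if_false, Polynomial.eval_zero, zero_mul, mul_zero,
        intervalIntegral.integral_zero, add_zero]
      refine Finset.sum_congr rfl fun k hk => ?_
      rw [if_pos (Finset.mem_range.1 hk)]
    · rw [Finset.sum_range_succ' _ (m+2)]
      simp

lemma taylor_bound (m : ℕ) : ∃ C : ℝ, 0 ≤ C ∧ ∀ (F : ℕ → ℝ → ℝ) (G : ℝ → ℝ),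
    (∀ k < m + 1, ∀ s ∈ Set.Icc (0:ℝ) 1, HasDerivAt (F k) (F (k+1) s) s) →
    ContinuousOn (F (m+1)) (Set.Icc 0 1) →
    (∀ k ≤ m + 1, ∀ s ∈ Set.Icc (0:ℝ) 1, |F k s| ≤ G s) →
    ENNReal.ofReal |F 0 0| ≤ ENNReal.ofReal C *
      ∫⁻ s in Set.Ioo (0:ℝ) 1, ENNReal.ofReal (s^m) * ENNReal.ofReal (G s) := by
  obtain ⟨P, hP⟩ := taylor_signed m
  have hM : ∀ k, ∃ M : ℝ, 0 ≤ M ∧ ∀ s ∈ Set.Icc (0:ℝ) 1, |(P k).eval s| ≤ M := by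
    intro k
    obtain ⟨M, hM⟩ := (isCompact_Icc (a := (0:ℝ)) (b := 1)).exists_bound_of_continuousOn
      (f := fun s => (P k).eval s) (by fun_prop)
    exact ⟨M, (norm_nonneg _).trans (hM 0 (by simp)), fun s hs => hM s hs⟩
  choose M hM0 hM using hM
  refine ⟨∑ k ∈ Finset.range (m+2), M k, Finset.sum_nonneg fun k _ => hM0 k,
    fun F G hF hc hG => ?_⟩
  rw [hP F hF hc, ENNReal.ofReal_sum_of_nonneg (fun k _ => hM0 k), Finset.sum_mul]
  refine (ENNReal.ofReal_le_ofReal (Finset.abs_sum_le_sum_abs _ _)).trans ?_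
  rw [ENNReal.ofReal_sum_of_nonneg (fun k _ => abs_nonneg _)]
  refine Finset.sum_le_sum fun k hk => ?_
  have hk := Finset.mem_range.1 hk
  rw [intervalIntegral.integral_of_le zero_le_one, ← MeasureTheory.integral_Ioc_eq_integral_Ioo.symm,
    ← Real.enorm_eq_ofReal_abs]
  refine (enorm_integral_le_lintegral_enorm _).trans ?_
  rw [← MeasureTheory.lintegral_const_mul' _ _ ENNReal.ofReal_ne_top]
  refine MeasureTheory.setLIntegral_mono' measurableSet_Ioo fun s hs => ?_
  have hs' := Set.Ioo_subset_Icc_self hs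
  rw [Real.enorm_eq_ofReal_abs, ← ENNReal.ofReal_mul (pow_nonneg hs'.1 _),
    ← ENNReal.ofReal_mul (hM0 k)]
  apply ENNReal.ofReal_le_ofReal
  rw [abs_mul, abs_mul, abs_of_nonneg (pow_nonneg hs'.1 _)]
  have h1 := hM k s hs'
  have h2 := hG k (by omega) s hs'
  have h3 : |(P k).eval s| * |F k s| ≤ M k * G s :=
    mul_le_mul h1 h2 (abs_nonneg _) (hM0 k)
  calc _ ≤ s^m * (M k * G s) := mul_le_mul_of_nonneg_left h3 (pow_nonneg hs'.1 _)
    _ = _ := by ring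

lemma vf_contDiff {n : ℕ} (a : VFIdx n) {f : (Fin (n+1) → ℝ) → ℝ} (hf : ContDiff ℝ (⊤:ℕ∞) f) :
    ContDiff ℝ (⊤:ℕ∞) (vf a f) := by
  have hpd : ∀ i : Fin (n+1), ContDiff ℝ (⊤:ℕ∞) (fun y => pd i f y) := by
    intro i
    exact (hf.fderiv_right (m := ((⊤:ℕ∞) : WithTop ℕ∞)) (by simp)).clm_apply contDiff_const
  have hy : ∀ i : Fin (n+1), ContDiff ℝ (⊤:ℕ∞) (fun y : Fin (n+1) → ℝ => y i) :=
    fun i => contDiff_apply ℝ ℝ i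
  rcases a with i | _ | q | i
  · exact hpd i
  · exact ContDiff.sum fun i _ => (hy i).mul (hpd i)
  · exact ((hy _).mul (hpd _)).sub ((hy _).mul (hpd _))
  · exact ((hy _).mul (hpd _)).add ((hy _).mul (hpd _))

/-- Sum of all the iterated vector fields up to order `N`. -/
def SZ {n : ℕ} : ℕ → ((Fin (n+1) → ℝ) → ℝ) → (Fin (n+1) → ℝ) → ℝ
  | 0, f, y => |f y|
  | N+1, f, y => |f y| + ∑ a : VFIdx n, SZ N (vf a f) y

lemma SZ_nonneg {n : ℕ} (N : ℕ) (f : (Fin (n+1) → ℝ) → ℝ) (y : Fin (n+1) → ℝ) :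
    0 ≤ SZ N f y := by
  induction N generalizing f with
  | zero => exact abs_nonneg _
  | succ N ih => exact add_nonneg (abs_nonneg _) (Finset.sum_nonneg fun a _ => ih _)

lemma abs_le_SZ {n : ℕ} (N : ℕ) (f : (Fin (n+1) → ℝ) → ℝ) (y : Fin (n+1) → ℝ) :
    |f y| ≤ SZ N f y := by
  cases N with
  | zero => exact le_rfl
  | succ N => exact le_add_of_nonneg_right (Finset.sum_nonneg fun a _ => SZ_nonneg _ _ _)

lemma SZ_le_succ {n : ℕ} (N : ℕ) (f : (Fin (n+1) → ℝ) → ℝ) (y : Fin (n+1) → ℝ) :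
    SZ N f y ≤ SZ (N+1) f y := by
  induction N generalizing f with
  | zero => exact abs_le_SZ _ _ _
  | succ N ih =>
    show |f y| + ∑ a : VFIdx n, SZ N (vf a f) y ≤ |f y| + ∑ a : VFIdx n, SZ (N+1) (vf a f) y
    gcongr
    exact ih _

lemma SZ_continuous {n : ℕ} (N : ℕ) {f : (Fin (n+1) → ℝ) → ℝ} (hf : ContDiff ℝ (⊤:ℕ∞) f) :
    Continuous (SZ N f) := by
  induction N generalizing f with
  | zero => exact hf.continuous.abs
  | succ N ih =>
    exact hf.continuous.abs.add (continuous_finsetSum _ fun a _ => ih (vf_contDiff a hf))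

lemma Zpow_snoc {n l : ℕ} (I : Fin l → VFIdx n) (a : VFIdx n) (f : (Fin (n+1) → ℝ) → ℝ) :
    Zpow (Fin.snoc I a : Fin (l+1) → VFIdx n) f = Zpow I (vf a f) := by
  unfold Zpow
  rw [List.ofFn_succ']
  simp

/-- slice norms, recursively. -/
def TZ {n : ℕ} (t : ℝ) (p : ℝ≥0∞) : ℕ → ((Fin (n+1) → ℝ) → ℝ) → ℝ≥0∞
  | 0, f => sliceNorm f t p
  | N+1, f => sliceNorm f t p + ∑ a : VFIdx n, TZ t p N (vf a f)

lemma TZ_eq {n : ℕ} (t : ℝ) (p : ℝ≥0∞) (N : ℕ) (f : (Fin (n+1) → ℝ) → ℝ) :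
    TZ t p N f = ∑ l ∈ Finset.range (N + 1), ∑ I : Fin l → VFIdx n, sliceNorm (Zpow I f) t p := by
  induction N generalizing f with
  | zero => simp [TZ, Zpow]
  | succ N ih =>
    rw [Finset.sum_range_succ' _ (N+1)]
    simp only [TZ, ih]
    rw [add_comm, Finset.sum_comm]
    congr 1
    · refine Finset.sum_congr rfl fun l _ => ?_
      rw [← (Fin.snocEquiv (fun _ : Fin (l+1) => VFIdx n)).sum_comp, Fintype.sum_prod_type]
      refine Finset.sum_congr rfl fun a _ => Finset.sum_congr rfl fun I _ => ?_
      rw [← Zpow_snoc]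
      rfl
    · simp [Zpow]

lemma SZ_norm_le {n : ℕ} (t : ℝ) (p : ℝ≥0∞) (hp : 1 ≤ p) (N : ℕ) {f : (Fin (n+1) → ℝ) → ℝ}
    (hf : ContDiff ℝ (⊤:ℕ∞) f) : sliceNorm (SZ N f) t p ≤ TZ t p N f := by
  have hc : Continuous (fun x : Fin n → ℝ => (Fin.cons t x : Fin (n+1) → ℝ)) := by fun_prop
  induction N generalizing f with
  | zero =>
    refine le_of_eq ?_
    exact eLpNorm_norm (fun x : Fin n → ℝ => f (Fin.cons t x))
  | succ N ih =>
    have h1 : sliceNorm (SZ (N+1) f) t p ≤ sliceNorm (fun y => |f y|) t p +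
        sliceNorm (fun y => ∑ a : VFIdx n, SZ N (vf a f) y) t p := by
      refine eLpNorm_add_le (f := fun x : Fin n → ℝ => |f (Fin.cons t x)|)
        (g := fun x : Fin n → ℝ => ∑ a : VFIdx n, SZ N (vf a f) (Fin.cons t x)) ?_ ?_ hp
      · exact (hf.continuous.abs.comp hc).aestronglyMeasurable
      · exact (continuous_finsetSum _ fun a _ =>
          (SZ_continuous N (vf_contDiff a hf)).comp hc).aestronglyMeasurable
    refine h1.trans (add_le_add (le_of_eq ?_) ?_)
    · exact eLpNorm_norm (fun x : Fin n → ℝ => f (Fin.cons t x))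
    · have h2 : sliceNorm (fun y => ∑ a : VFIdx n, SZ N (vf a f) y) t p ≤
          ∑ a : VFIdx n, sliceNorm (SZ N (vf a f)) t p := by
        have := eLpNorm_sum_le (μ := volume) (s := Finset.univ) (p := p)
          (f := fun (a : VFIdx n) (x : Fin n → ℝ) => SZ N (vf a f) (Fin.cons t x))
          (fun a _ => ((SZ_continuous N (vf_contDiff a hf)).comp hc).aestronglyMeasurable) hp
        refine le_trans (le_of_eq ?_) this
        unfold sliceNorm
        congr 1
        funext x
        simp
      exact h2.trans (Finset.sum_le_sum fun a _ => ih (vf_contDiff a hf))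

lemma chain_rep {n : ℕ} {ι : Type} (γ : ι → ℝ → (Fin (n+1) → ℝ)) (c : VFIdx n → ι → ℝ → ℝ)
    (hγ : ∀ f : (Fin (n+1) → ℝ) → ℝ, ContDiff ℝ (⊤:ℕ∞) f → ∀ i, ∀ s ∈ Set.Icc (0:ℝ) 1,
      HasDerivAt (fun s => f (γ i s)) (∑ a, c a i s * vf a f (γ i s)) s)
    (hc : ∀ k a, BD k (c a)) (N : ℕ) (d : ι → ℝ → ℝ) (hd : BD N d) :
    ∃ C : ℝ, 0 ≤ C ∧ ∀ f : (Fin (n+1) → ℝ) → ℝ, ContDiff ℝ (⊤:ℕ∞) f → ∀ i,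
      ∃ F : ℕ → ℝ → ℝ, (F 0 = fun s => d i s * f (γ i s)) ∧
      (∀ k < N, ∀ s ∈ Set.Icc (0:ℝ) 1, HasDerivAt (F k) (F (k+1) s) s) ∧
      ContinuousOn (F N) (Set.Icc 0 1) ∧
      ∀ k ≤ N, ∀ s ∈ Set.Icc (0:ℝ) 1, |F k s| ≤ C * SZ N f (γ i s) := by
  induction N generalizing d with
  | zero =>
    obtain ⟨M, hM⟩ := hd.bdd
    refine ⟨|M|, abs_nonneg _, fun f hf i => ⟨fun _ s => d i s * f (γ i s), rfl, by simp, ?_, ?_⟩⟩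
    · exact (hd.cont i).mul fun s hs => (hγ f hf i s hs).continuousAt.continuousWithinAt
    · intro k _ s hs
      rw [abs_mul]
      exact mul_le_mul_of_nonneg_right ((hM i s hs).trans (le_abs_self M)) (abs_nonneg _)
  | succ N ih =>
    have hd0 := hd.down
    obtain ⟨M, hM⟩ := hd.bdd
    obtain ⟨_, d', hdd, hd'⟩ := hd
    obtain ⟨C0, hC0, h0⟩ := ih d' hd'
    have h1 := fun a => ih (fun i s => d i s * c a i s) (hd0.mul (hc N a))
    choose C1 hC1 h1 using h1
    refine ⟨|M| + C0 + ∑ a, C1 a, by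
      have := Finset.sum_nonneg fun a (_ : a ∈ Finset.univ) => hC1 a
      positivity, fun f hf i => ?_⟩
    obtain ⟨F0, hF00, hF0d, hF0c, hF0b⟩ := h0 f hf i
    have h1' := fun a => h1 a (vf a f) (vf_contDiff a hf) i
    choose F1 hF10 hF1d hF1c hF1b using h1'
    refine ⟨fun k => match k with
      | 0 => fun s => d i s * f (γ i s)
      | k+1 => fun s => F0 k s + ∑ a, F1 a k s, rfl, ?_, ?_, ?_⟩
    · intro k hk s hs
      cases k with
      | zero =>
        refine ((hdd i s hs).mul (hγ f hf i s hs)).congr_deriv ?_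
        simp only [hF00, hF10, Finset.mul_sum, mul_assoc]
      | succ k =>
        exact (hF0d k (by omega) s hs).add
          (HasDerivAt.fun_sum fun a _ => hF1d a k (by omega) s hs)
    · exact hF0c.add (continuousOn_finsetSum _ fun a _ => hF1c a)
    · intro k hk s hs
      have hS := SZ_nonneg (N+1) f (γ i s)
      have hsum := Finset.sum_nonneg fun a (_ : a ∈ Finset.univ) => hC1 a
      cases k with
      | zero =>
        simp only [abs_mul]
        have h1 : |d i s| * |f (γ i s)| ≤ |M| * SZ (N+1) f (γ i s) :=
          mul_le_mul ((hM i s hs).trans (le_abs_self M)) (abs_le_SZ _ _ _) (abs_nonneg _)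
            (abs_nonneg _)
        nlinarith [mul_nonneg hC0 hS, mul_nonneg hsum hS]
      | succ k =>
        have e1 : |F0 k s| ≤ C0 * SZ (N+1) f (γ i s) :=
          (hF0b k (by omega) s hs).trans (mul_le_mul_of_nonneg_left (SZ_le_succ _ _ _) hC0)
        have e2 : ∀ a, |F1 a k s| ≤ C1 a * SZ (N+1) f (γ i s) := fun a => by
          refine (hF1b a k (by omega) s hs).trans (mul_le_mul_of_nonneg_left ?_ (hC1 a))
          refine (Finset.single_le_sum (f := fun a => SZ N (vf a f) (γ i s))
            (fun a _ => SZ_nonneg _ _ _) (Finset.mem_univ a)).trans ?_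
          exact le_add_of_nonneg_left (abs_nonneg _)
        have e3 : |∑ a, F1 a k s| ≤ (∑ a, C1 a) * SZ (N+1) f (γ i s) := by
          rw [Finset.sum_mul]
          exact (Finset.abs_sum_le_sum_abs _ _).trans (Finset.sum_le_sum fun a _ => e2 a)
        show |F0 k s + ∑ a, F1 a k s| ≤ _
        have := abs_add_le (F0 k s) (∑ a, F1 a k s)
        nlinarith [mul_nonneg (abs_nonneg M) hS]

lemma ball_scale {n : ℕ} (g : EuclideanSpace ℝ (Fin n) → ℝ≥0∞) (hg : Measurable g)
    (s : ℝ) (hs : s ∈ Set.Ioo (0:ℝ) 1) :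
    ∫⁻ z in Metric.ball (0 : EuclideanSpace ℝ (Fin n)) (1/2), g (s • z) ≤
      ENNReal.ofReal ((s^n)⁻¹) * ∫⁻ w in Metric.ball (0 : EuclideanSpace ℝ (Fin n)) (1/2), g w := by
  have hs0 : s ≠ 0 := hs.1.ne'
  rw [← lintegral_indicator Metric.isOpen_ball.measurableSet,
    ← lintegral_indicator Metric.isOpen_ball.measurableSet]
  calc ∫⁻ z, (Metric.ball (0 : EuclideanSpace ℝ (Fin n)) (1/2)).indicator (fun z => g (s • z)) z
      ≤ ∫⁻ z, (Metric.ball (0 : EuclideanSpace ℝ (Fin n)) (1/2)).indicator g (s • z) := by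
        refine lintegral_mono fun z => ?_
        by_cases hz : z ∈ Metric.ball (0 : EuclideanSpace ℝ (Fin n)) (1/2)
        · have : s • z ∈ Metric.ball (0 : EuclideanSpace ℝ (Fin n)) (1/2) := by
            rw [mem_ball_zero_iff] at hz ⊢
            rw [norm_smul, Real.norm_eq_abs, abs_of_pos hs.1]
            nlinarith [norm_nonneg z, hs.1, hs.2]
          simp only [Set.indicator_of_mem hz, Set.indicator_of_mem this]
          exact le_rfl
        · simp only [Set.indicator_of_notMem hz]
          exact zero_le
    _ = ∫⁻ w, (Metric.ball (0 : EuclideanSpace ℝ (Fin n)) (1/2)).indicator g w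
          ∂(Measure.map (s • ·) volume) := by
        rw [lintegral_map (hg.indicator Metric.isOpen_ball.measurableSet) (by fun_prop)]
    _ = _ := by
        rw [Measure.map_addHaar_smul _ hs0, lintegral_smul_measure]
        simp [abs_of_pos hs.1]

lemma avg (n m : ℕ) (p : ℝ) (hp : 1 ≤ p) (h : (n:ℝ)/p < m + 1) :
    ∃ C : ℝ≥0∞, C ≠ ⊤ ∧ ∀ (Γ : EuclideanSpace ℝ (Fin n) → EuclideanSpace ℝ (Fin n))
      (_ : Measurable Γ) (K : ℝ≥0∞)
      (_ : ∀ g : EuclideanSpace ℝ (Fin n) → ℝ≥0∞, Measurable g →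
        ∫⁻ w in Metric.ball (0 : EuclideanSpace ℝ (Fin n)) (1/2), g (Γ w) ≤ K * ∫⁻ x, g x)
      (S : EuclideanSpace ℝ (Fin n) → ℝ≥0∞) (_ : Measurable S) (u A : ℝ≥0∞)
      (_ : ∀ z ∈ Metric.ball (0 : EuclideanSpace ℝ (Fin n)) (1/2),
        u ≤ A * ∫⁻ s in Set.Ioo (0:ℝ) 1, ENNReal.ofReal (s^m) * S (Γ (s • z))),
      u ≤ A * C * K^(1/p) * (∫⁻ x, S x ^ p)^(1/p) := by
  have hp0 : 0 < p := by linarith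
  set B := Metric.ball (0 : EuclideanSpace ℝ (Fin n)) (1/2) with hB
  set V := volume B with hV
  have hV0 : V ≠ 0 := (Metric.measure_ball_pos _ _ (by norm_num)).ne'
  have hVt : V ≠ ⊤ := measure_ball_lt_top.ne
  set J : ℝ≥0∞ := ∫⁻ s in Set.Ioo (0:ℝ) 1, ENNReal.ofReal (s^((m:ℝ) - n/p)) with hJ
  have hJt : J ≠ ⊤ := by
    have hi : IntegrableOn (fun s : ℝ => s^((m:ℝ) - n/p)) (Set.Ioo 0 1) :=
      (intervalIntegral.integrableOn_Ioo_rpow_iff one_pos).2 (by linarith)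
    have := hi.lintegral_lt_top
    exact this.ne
  refine ⟨J * V^(1 - 1/p) * V⁻¹, ?_, ?_⟩
  · refine ENNReal.mul_ne_top (ENNReal.mul_ne_top hJt ?_) (ENNReal.inv_ne_top.2 hV0)
    refine ENNReal.rpow_ne_top_of_nonneg ?_ hVt
    rw [sub_nonneg, div_le_one hp0]; exact hp
  intro Γ hΓ K hK S hS u A hu
  have hmeas : Measurable (fun q : EuclideanSpace ℝ (Fin n) × ℝ =>
      ENNReal.ofReal (q.2^m) * S (Γ (q.2 • q.1))) := by fun_prop
  have h1 : u * V ≤ A * ∫⁻ z in B, ∫⁻ s in Set.Ioo (0:ℝ) 1,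
      ENNReal.ofReal (s^m) * S (Γ (s • z)) := by
    rw [← setLIntegral_const]
    rw [← lintegral_const_mul _ (Measurable.lintegral_prod_right hmeas)]
    exact setLIntegral_mono' Metric.isOpen_ball.measurableSet fun z hz => hu z hz
  rw [lintegral_lintegral_swap hmeas.aemeasurable] at h1
  set I := ∫⁻ x, S x ^ p with hI
  have h2 : ∀ s ∈ Set.Ioo (0:ℝ) 1, ∫⁻ z in B, ENNReal.ofReal (s^m) * S (Γ (s • z)) ≤
      ENNReal.ofReal (s^((m:ℝ) - n/p)) * (K^(1/p) * I^(1/p) * V^(1-1/p)) := by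
    intro s hs
    have hm1 : Measurable (fun z => S (Γ (s • z))) := by fun_prop
    rw [lintegral_const_mul _ hm1]
    have hH := eLpNorm'_le_eLpNorm'_mul_rpow_measure_univ (μ := volume.restrict B)
      (f := fun z => S (Γ (s • z))) (p := 1) (q := p) one_pos hp hm1.aestronglyMeasurable
    simp only [eLpNorm', enorm_eq_self, ENNReal.rpow_one, div_one, Measure.restrict_apply_univ] at hH
    have hs1 : ∫⁻ z in B, S (Γ (s • z)) ^ p ≤ ENNReal.ofReal ((s^n)⁻¹) * (K * I) := by
      refine (ball_scale (fun w => S (Γ w) ^ p) (by fun_prop) s hs).trans ?_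
      gcongr
      exact hK (fun x => S x ^ p) (by fun_prop)
    have hs2 : (∫⁻ z in B, S (Γ (s • z)) ^ p) ^ (1/p) ≤
        ENNReal.ofReal (s^(-(n/p):ℝ)) * (K^(1/p) * I^(1/p)) := by
      refine (ENNReal.rpow_le_rpow hs1 (by positivity)).trans (le_of_eq ?_)
      rw [ENNReal.mul_rpow_of_nonneg _ _ (by positivity), ENNReal.mul_rpow_of_nonneg _ _ (by positivity)]
      congr 1
      rw [ENNReal.ofReal_rpow_of_nonneg (by have := hs.1; positivity) (by positivity)]
      congr 1
      rw [← Real.rpow_natCast, ← Real.rpow_neg hs.1.le, ← Real.rpow_mul hs.1.le]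
      congr 1
      ring
    calc _ ≤ ENNReal.ofReal (s^m) * (ENNReal.ofReal (s^(-(n/p):ℝ)) * (K^(1/p) * I^(1/p)) * V^(1-1/p)) := by
            gcongr
            refine hH.trans ?_
            gcongr
      _ = _ := by
            rw [sub_eq_add_neg (m:ℝ), Real.rpow_add hs.1, Real.rpow_natCast,
              ENNReal.ofReal_mul (by have := hs.1; positivity)]
            ring
  have h3 : u * V ≤ A * (J * (K^(1/p) * I^(1/p) * V^(1-1/p))) := by
    refine h1.trans ?_
    gcongr
    rw [hJ, ← lintegral_mul_const _ (by fun_prop)]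
    exact setLIntegral_mono' measurableSet_Ioo h2
  calc u = u * V * V⁻¹ := by rw [mul_assoc, ENNReal.mul_inv_cancel hV0 hVt, mul_one]
    _ ≤ A * (J * (K^(1/p) * I^(1/p) * V^(1-1/p))) * V⁻¹ := by gcongr
    _ = _ := by ring

lemma polar_lintegral {n : ℕ} (hn : 0 < n) (g : EuclideanSpace ℝ (Fin n) → ℝ≥0∞)
    (hg : Measurable g) :
    ∫⁻ x, g x = ∫⁻ σ : Metric.sphere (0 : EuclideanSpace ℝ (Fin n)) 1,
      (∫⁻ r in Set.Ioi (0:ℝ), ENNReal.ofReal (r^(n-1)) * g (r • (σ : EuclideanSpace ℝ (Fin n))))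
      ∂(volume : Measure (EuclideanSpace ℝ (Fin n))).toSphere := by
  have : Nonempty (Fin n) := ⟨⟨0, hn⟩⟩
  have h1 : ∫⁻ x, g x = ∫⁻ x : ({(0 : EuclideanSpace ℝ (Fin n))}ᶜ : Set (EuclideanSpace ℝ (Fin n))), g x.1
      ∂(volume.comap Subtype.val) := by
    rw [lintegral_subtype_comap (measurableSet_singleton _).compl,
      restrict_compl_singleton]
  have hmp := (volume : Measure (EuclideanSpace ℝ (Fin n))).measurePreserving_homeomorphUnitSphereProd
  rw [h1]
  have hm : Measurable (fun q : Metric.sphere (0 : EuclideanSpace ℝ (Fin n)) 1 × Set.Ioi (0:ℝ) =>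
      g ((q.2 : ℝ) • (q.1 : EuclideanSpace ℝ (Fin n)))) := by fun_prop
  have h2 := hmp.lintegral_comp hm
  rw [lintegral_prod _ hm.aemeasurable] at h2
  convert h2 using 1
  · refine lintegral_congr fun x => ?_
    have hx : ‖(x : EuclideanSpace ℝ (Fin n))‖ ≠ 0 := norm_ne_zero_iff.2 x.2
    simp [smul_smul, hx]
  · refine lintegral_congr fun σ => ?_
    rw [Measure.volumeIoiPow, lintegral_withDensity_eq_lintegral_mul _ (by fun_prop) (by fun_prop)]
    have := lintegral_subtype_comap (μ := volume) (measurableSet_Ioi (a := (0:ℝ)))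
      (fun r => ENNReal.ofReal (r^(n-1)) * g (r • (σ : EuclideanSpace ℝ (Fin n))))
    simp only [finrank_euclideanSpace, Fintype.card_fin]
    exact this.symm

lemma affine_sub (g : ℝ → ℝ≥0∞) (hg : Measurable g) (a δ : ℝ) (hδ : 0 < δ) :
    ∫⁻ r, g (a + δ * r) = ENNReal.ofReal δ⁻¹ * ∫⁻ r, g r := by
  have h1 : ∫⁻ r, g (a + δ * r) = ∫⁻ r, (fun u => g (a + u)) (δ * r) := rfl
  rw [h1]
  have h2 : ∫⁻ r, (fun u => g (a + u)) (δ * r) = ∫⁻ u, (fun u => g (a + u)) u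
      ∂(Measure.map (δ * ·) volume) := by
    rw [lintegral_map (by fun_prop) (by fun_prop)]
  rw [h2, Real.map_volume_mul_left hδ.ne', lintegral_smul_measure, abs_of_pos (inv_pos.2 hδ)]
  congr 1
  exact lintegral_add_left_eq_self g a

lemma radial_change {n : ℕ} (hn : 0 < n) (r₀ δ : ℝ) (hr : 0 < r₀) (hδ : 0 < δ) (hδr : δ ≤ r₀)
    (ω : EuclideanSpace ℝ (Fin n)) (hω : ‖ω‖ = 1)
    (g : EuclideanSpace ℝ (Fin n) → ℝ≥0∞) (hg : Measurable g) :
    ∫⁻ w in Metric.ball (0 : EuclideanSpace ℝ (Fin n)) (1/2),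
      g (((r₀ + δ * (‖ω + w‖ - 1)) * ‖ω + w‖⁻¹) • (ω + w)) ≤
    ENNReal.ofReal (3^(n-1) * (r₀^(n-1))⁻¹ * δ⁻¹) * ∫⁻ x, g x := by
  set T : Set (EuclideanSpace ℝ (Fin n)) := {v | ‖v‖ ∈ Set.Ioo (1/2:ℝ) (3/2)} with hT
  have hTm : MeasurableSet T := measurable_norm measurableSet_Ioo
  set k : EuclideanSpace ℝ (Fin n) → ℝ≥0∞ :=
    fun v => g (((r₀ + δ * (‖v‖ - 1)) * ‖v‖⁻¹) • v) with hk
  have hkm : Measurable k := by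
    rw [hk]; fun_prop
  have h1 : ∫⁻ w in Metric.ball (0 : EuclideanSpace ℝ (Fin n)) (1/2), k (ω + w) ≤
      ∫⁻ v, T.indicator k v := by
    rw [← lintegral_indicator Metric.isOpen_ball.measurableSet,
      ← lintegral_add_left_eq_self (T.indicator k) ω]
    refine lintegral_mono fun w => ?_
    by_cases hw : w ∈ Metric.ball (0 : EuclideanSpace ℝ (Fin n)) (1/2)
    · have : ω + w ∈ T := by
        rw [mem_ball_zero_iff] at hw
        have e1 := norm_add_le ω w
        have e2 := norm_sub_le (ω + w) w
        rw [add_sub_cancel_right] at e2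
        exact ⟨by linarith, by linarith⟩
      simp only [Set.indicator_of_mem hw, Set.indicator_of_mem this]
      exact le_rfl
    · simp only [Set.indicator_of_notMem hw]
      exact zero_le
  refine h1.trans ?_
  rw [polar_lintegral hn _ (hkm.indicator hTm), polar_lintegral hn g hg,
    ← lintegral_const_mul' _ _ ENNReal.ofReal_ne_top]
  refine lintegral_mono fun σ => ?_
  have hσ : ‖(σ : EuclideanSpace ℝ (Fin n))‖ = 1 := by simp
  set G : ℝ → ℝ≥0∞ := (Set.Ioi (0:ℝ)).indicator
    (fun r => ENNReal.ofReal (r^(n-1)) * g (r • (σ : EuclideanSpace ℝ (Fin n)))) with hG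
  have hGm : Measurable G := Measurable.indicator (by fun_prop) measurableSet_Ioi
  rw [← lintegral_indicator measurableSet_Ioi, ← lintegral_indicator measurableSet_Ioi]
  have h2 := affine_sub G hGm (r₀ - δ) δ hδ
  calc _ ≤ ∫⁻ r, ENNReal.ofReal (3^(n-1) * (r₀^(n-1))⁻¹) * G (r₀ - δ + δ * r) := ?_
    _ = _ := by
      rw [lintegral_const_mul' _ _ ENNReal.ofReal_ne_top, h2, ← mul_assoc,
        ← ENNReal.ofReal_mul (by positivity)]
  refine lintegral_mono fun r => ?_
  by_cases hr0 : r ∈ Set.Ioi (0:ℝ)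
  swap
  · simp only [Set.indicator_of_notMem hr0]
    exact zero_le
  have hr0' : 0 < r := hr0
  simp only [Set.indicator_of_mem hr0]
  have hnr : ‖r • (σ : EuclideanSpace ℝ (Fin n))‖ = r := by
    rw [norm_smul, hσ, mul_one, Real.norm_eq_abs, abs_of_pos hr0']
  by_cases hrT : r • (σ : EuclideanSpace ℝ (Fin n)) ∈ T
  swap
  · simp only [Set.indicator_of_notMem hrT, mul_zero]
    exact zero_le
  rw [Set.indicator_of_mem hrT]
  have hr2 : r ∈ Set.Ioo (1/2:ℝ) (3/2) := by
    have : ‖r • (σ : EuclideanSpace ℝ (Fin n))‖ ∈ Set.Ioo (1/2:ℝ) (3/2) := hrT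
    rwa [hnr] at this
  have hh : r₀ / 2 ≤ r₀ - δ + δ * r := by nlinarith [hr2.1]
  have hmem : r₀ - δ + δ * r ∈ Set.Ioi (0:ℝ) := lt_of_lt_of_le (by positivity) hh
  simp only [hG, Set.indicator_of_mem hmem, hk, hnr, smul_smul]
  rw [← mul_assoc, ← ENNReal.ofReal_mul (by positivity)]
  have e : (r₀ + δ * (r - 1)) * r⁻¹ * r = r₀ - δ + δ * r := by
    field_simp
    ring
  rw [e]
  gcongr
  calc r^(n-1) ≤ (3 * r₀⁻¹ * (r₀ - δ + δ * r))^(n-1) := by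
        refine pow_le_pow_left₀ hr0'.le ?_ _
        have : 3 * r₀⁻¹ * (r₀/2) ≤ 3 * r₀⁻¹ * (r₀ - δ + δ * r) := by gcongr
        have e : 3 * r₀⁻¹ * (r₀/2) = 3/2 := by field_simp
        linarith [hr2.2]
    _ = _ := by rw [mul_pow, mul_pow, inv_pow]

lemma affine_change {n : ℕ} (x : EuclideanSpace ℝ (Fin n)) (δ : ℝ) (hδ : 0 < δ)
    (g : EuclideanSpace ℝ (Fin n) → ℝ≥0∞) (hg : Measurable g) :
    ∫⁻ w in Metric.ball (0 : EuclideanSpace ℝ (Fin n)) (1/2), g (x + δ • w) ≤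
    ENNReal.ofReal ((δ^n)⁻¹) * ∫⁻ x, g x := by
  refine (setLIntegral_le_lintegral _ _).trans ?_
  have h2 : ∫⁻ w, (fun u => g (x + u)) (δ • w) = ∫⁻ u, (fun u => g (x + u)) u
      ∂(Measure.map (δ • ·) (volume : Measure (EuclideanSpace ℝ (Fin n)))) := by
    rw [lintegral_map (by fun_prop) (by fun_prop)]
  refine (le_of_eq h2).trans ?_
  rw [Measure.map_addHaar_smul _ hδ.ne', lintegral_smul_measure]
  rw [lintegral_add_left_eq_self g x]
  simp [abs_of_pos hδ]

lemma rot_sum {n : ℕ} (a b y D : Fin n → ℝ) :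
    ∑ q : {p : Fin n × Fin n // p.1 < p.2}, (a q.1.1 * b q.1.2 - a q.1.2 * b q.1.1) *
      (y q.1.1 * D q.1.2 - y q.1.2 * D q.1.1) =
    (∑ i, a i * y i) * (∑ i, b i * D i) - (∑ i, a i * D i) * (∑ i, b i * y i) := by
  set G : Fin n × Fin n → ℝ := fun p => (a p.1 * b p.2 - a p.2 * b p.1) *
      (y p.1 * D p.2 - y p.2 * D p.1) with hG
  have h1 : ∑ q : {p : Fin n × Fin n // p.1 < p.2}, G q.1 =
      ∑ p : Fin n × Fin n, if p.1 < p.2 then G p else 0 := by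
    rw [← Finset.sum_filter, Finset.sum_subtype (p := fun p : Fin n × Fin n => p.1 < p.2)]
    simp
  have h2 : ∑ p : Fin n × Fin n, (if p.1 < p.2 then G p else 0) =
      ∑ p : Fin n × Fin n, if p.2 < p.1 then G p else 0 := by
    rw [← (Equiv.prodComm (Fin n) (Fin n)).sum_comp]
    refine Finset.sum_congr rfl fun p _ => ?_
    simp only [Equiv.prodComm_apply, Prod.fst_swap, Prod.snd_swap]
    congr 1
    simp only [hG, Prod.fst_swap, Prod.snd_swap]
    ring
  have h3 : (∑ p : Fin n × Fin n, if p.1 < p.2 then G p else 0) +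
      (∑ p : Fin n × Fin n, if p.2 < p.1 then G p else 0) = ∑ p, G p := by
    rw [← Finset.sum_add_distrib]
    refine Finset.sum_congr rfl fun p _ => ?_
    rcases lt_trichotomy p.1 p.2 with h | h | h
    · simp [h, h.le.not_gt]
    · simp [h, hG]
    · simp [h, h.le.not_gt]
  have h4 : ∑ p, G p = 2 * ((∑ i, a i * y i) * (∑ i, b i * D i) -
      (∑ i, a i * D i) * (∑ i, b i * y i)) := by
    rw [Fintype.sum_prod_type]
    have e1 : (∑ i, a i * y i) * (∑ i, b i * D i) = ∑ i, ∑ j, a i * y i * (b j * D j) :=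
      Finset.sum_mul_sum _ _ _ _
    have e1' : (∑ i, a i * y i) * (∑ i, b i * D i) = ∑ i, ∑ j, a j * y j * (b i * D i) := by
      rw [e1, Finset.sum_comm]
    have e2 : (∑ i, a i * D i) * (∑ i, b i * y i) = ∑ i, ∑ j, a i * D i * (b j * y j) :=
      Finset.sum_mul_sum _ _ _ _
    have e2' : (∑ i, a i * D i) * (∑ i, b i * y i) = ∑ i, ∑ j, a j * D j * (b i * y i) := by
      rw [e2, Finset.sum_comm]
    rw [two_mul]
    nth_rewrite 1 [e1]
    nth_rewrite 1 [e2]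
    rw [e1', e2']
    simp only [← Finset.sum_sub_distrib, ← Finset.sum_add_distrib]
    refine Finset.sum_congr rfl fun i _ => Finset.sum_congr rfl fun j _ => ?_
    simp only [hG]
    ring
  have h5 : ∑ q : {p : Fin n × Fin n // p.1 < p.2}, G q.1 = (∑ i, a i * y i) * (∑ i, b i * D i) -
      (∑ i, a i * D i) * (∑ i, b i * y i) := by
    rw [h1]; linarith
  exact h5

/-- coefficients of a combination of the vector fields -/
def cf {n : ℕ} {ι : Type} (e : Fin n → ι → ℝ → ℝ) (l : ι → ℝ → ℝ)
    (R : Fin n → Fin n → ι → ℝ → ℝ) (b : Fin n → ι → ℝ → ℝ) : VFIdx n → ι → ℝ → ℝ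
  | Sum.inl i => Fin.cases (fun _ _ => 0) e i
  | Sum.inr (Sum.inl _) => l
  | Sum.inr (Sum.inr (Sum.inl q)) => R q.1.1 q.1.2
  | Sum.inr (Sum.inr (Sum.inr i)) => b i

lemma cf_BD {n : ℕ} {ι : Type} {e : Fin n → ι → ℝ → ℝ} {l : ι → ℝ → ℝ}
    {R : Fin n → Fin n → ι → ℝ → ℝ} {b : Fin n → ι → ℝ → ℝ} {k : ℕ}
    (he : ∀ i, BD k (e i)) (hl : BD k l) (hR : ∀ i j, BD k (R i j)) (hb : ∀ i, BD k (b i)) :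
    ∀ a, BD k (cf e l R b a) := by
  rintro (i | _ | q | i)
  · induction i using Fin.cases with
    | zero => exact BD.cst k 0
    | succ i => exact he i
  · exact hl
  · exact hR _ _
  · exact hb i

lemma cf_sum {n : ℕ} {ι : Type} (e : Fin n → ι → ℝ → ℝ) (l : ι → ℝ → ℝ)
    (R : Fin n → Fin n → ι → ℝ → ℝ) (b : Fin n → ι → ℝ → ℝ) (j : ι) (s : ℝ)
    (f : (Fin (n+1) → ℝ) → ℝ) (t : ℝ) (x : Fin n → ℝ) :
    ∑ a, cf e l R b a j s * vf a f (Fin.cons t x) =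
      (∑ i, e i j s * pd i.succ f (Fin.cons t x)) +
      (l j s * (t * pd 0 f (Fin.cons t x) + ∑ i, x i * pd i.succ f (Fin.cons t x)) +
      ((∑ q : {p : Fin n × Fin n // p.1 < p.2}, R q.1.1 q.1.2 j s *
        (x q.1.1 * pd q.1.2.succ f (Fin.cons t x) - x q.1.2 * pd q.1.1.succ f (Fin.cons t x))) +
      ∑ i, b i j s * (t * pd i.succ f (Fin.cons t x) + x i * pd 0 f (Fin.cons t x)))) := by
  rw [Fintype.sum_sum_type, Fintype.sum_sum_type, Fintype.sum_sum_type]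
  simp only [cf, vf, Fin.sum_univ_succ, Fin.cases_zero, Fin.cases_succ, Fin.cons_zero,
    Fin.cons_succ, zero_mul, zero_add, Finset.univ_unique, Finset.sum_singleton]

lemma curve_deriv {n : ℕ} {f : (Fin (n+1) → ℝ) → ℝ} (hf : ContDiff ℝ (⊤:ℕ∞) f) (t : ℝ)
    (x : ℝ → Fin n → ℝ) (x' : Fin n → ℝ) (s : ℝ)
    (hx : ∀ i, HasDerivAt (fun s => x s i) (x' i) s) :
    HasDerivAt (fun s => f (Fin.cons t (x s)))
      (∑ i, x' i * pd i.succ f (Fin.cons t (x s))) s := by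
  have h1 : HasDerivAt (fun s => (Fin.cons t (x s) : Fin (n+1) → ℝ)) (Fin.cons 0 x') s := by
    rw [hasDerivAt_pi]
    intro i
    induction i using Fin.cases with
    | zero => simpa using hasDerivAt_const s t
    | succ i => simpa using hx i
  have h2 := ((hf.differentiable (by simp)).differentiableAt (x := Fin.cons t (x s))).hasFDerivAt
  refine (h2.comp_hasDerivAt s h1).congr_deriv ?_
  rw [← ContinuousLinearMap.coe_coe, LinearMap.pi_apply_eq_sum_univ, Fin.sum_univ_succ]
  simp only [Fin.cons_zero, zero_mul, zero_add, Fin.cons_succ, smul_eq_mul]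
  refine Finset.sum_congr rfl fun i _ => ?_
  congr 1
  simp only [pd, ContinuousLinearMap.coe_coe]
  congr 1
  funext j
  simp [Pi.single_apply, eq_comm]

/-- The unit of parameters for the averaging directions. -/
abbrev HB (n : ℕ) := {z : EuclideanSpace ℝ (Fin n) // ‖z‖ < 1/2}

lemma core (n m : ℕ) (p : ℝ) (hp : 1 ≤ p) (h : (n:ℝ)/p < m + 1) {θ : Type} (t : θ → ℝ)
    (Γ : θ → EuclideanSpace ℝ (Fin n) → EuclideanSpace ℝ (Fin n)) (hΓ : ∀ i, Measurable (Γ i))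
    (K : θ → ℝ)
    (hK : ∀ i, ∀ g : EuclideanSpace ℝ (Fin n) → ℝ≥0∞, Measurable g →
        ∫⁻ w in Metric.ball (0 : EuclideanSpace ℝ (Fin n)) (1/2), g (Γ i w) ≤
          ENNReal.ofReal (K i) * ∫⁻ x, g x)
    (c : VFIdx n → (θ × HB n) → ℝ → ℝ)
    (hγ : ∀ f : (Fin (n+1) → ℝ) → ℝ, ContDiff ℝ (⊤:ℕ∞) f → ∀ i : θ × HB n,
      ∀ s ∈ Set.Icc (0:ℝ) 1,
      HasDerivAt (fun s => f (Fin.cons (t i.1) (fun j => Γ i.1 (s • i.2.1) j)))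
        (∑ a, c a i s * vf a f (Fin.cons (t i.1) (fun j => Γ i.1 (s • i.2.1) j))) s)
    (hc : ∀ k a, BD k (c a)) :
    ∃ C : ℝ, 0 ≤ C ∧ ∀ i, ∀ f : (Fin (n+1) → ℝ) → ℝ, ContDiff ℝ (⊤:ℕ∞) f →
      ENNReal.ofReal |f (Fin.cons (t i) (fun j => Γ i 0 j))| ≤
        ENNReal.ofReal C * ENNReal.ofReal (K i) ^ (1/p) *
          ∑ l ∈ Finset.range (m + 1 + 1), ∑ I : Fin l → VFIdx n,
              sliceNorm (Zpow I f) (t i) (ENNReal.ofReal p) := by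
  have hp0 : 0 < p := by linarith
  obtain ⟨C1, hC1, h1⟩ := chain_rep (fun (i : θ × HB n) s =>
    (Fin.cons (t i.1) (fun j => Γ i.1 (s • i.2.1) j) : Fin (n+1) → ℝ)) c hγ hc (m+1)
    (fun _ _ => 1) (BD.cst _ 1)
  obtain ⟨C2, hC2, h2⟩ := taylor_bound m
  obtain ⟨C3, hC3, h3⟩ := avg n m p hp h
  refine ⟨C2 * C1 * C3.toReal, by positivity, fun i f hf => ?_⟩
  rw [← TZ_eq]
  have hcc : Continuous (fun x : EuclideanSpace ℝ (Fin n) =>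
      (Fin.cons (t i) (fun j => x j) : Fin (n+1) → ℝ)) := by fun_prop
  have hSc : Continuous (fun x : EuclideanSpace ℝ (Fin n) =>
      SZ (m+1) f (Fin.cons (t i) (fun j => x j))) := (SZ_continuous _ hf).comp hcc
  have hS := h3 (Γ i) (hΓ i) _ (hK i)
    (fun x => ENNReal.ofReal (SZ (m+1) f (Fin.cons (t i) (fun j => x j))))
    hSc.measurable.ennreal_ofReal
    (ENNReal.ofReal |f (Fin.cons (t i) (fun j => Γ i 0 j))|) (ENNReal.ofReal (C2 * C1)) ?_
  · refine hS.trans ?_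
    have e1 : (∫⁻ x : EuclideanSpace ℝ (Fin n),
        ENNReal.ofReal (SZ (m+1) f (Fin.cons (t i) (fun j => x j))) ^ p) ^ (1/p) =
        sliceNorm (SZ (m+1) f) (t i) (ENNReal.ofReal p) := by
      unfold sliceNorm
      rw [eLpNorm_eq_lintegral_rpow_enorm_toReal (by simpa using hp0) ENNReal.ofReal_ne_top,
        ENNReal.toReal_ofReal hp0.le]
      congr 1
      have hm : Measurable (fun x : Fin n → ℝ => ‖SZ (m+1) f (Fin.cons (t i) x)‖ₑ ^ p) := by
        have : Continuous (fun x : Fin n → ℝ => SZ (m+1) f (Fin.cons (t i) x)) :=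
          (SZ_continuous _ hf).comp (by fun_prop)
        have := this.measurable
        fun_prop
      rw [← (PiLp.volume_preserving_ofLp (Fin n)).lintegral_comp hm]
      refine lintegral_congr fun x => ?_
      rw [Real.enorm_eq_ofReal (SZ_nonneg _ _ _)]
    have e2 : ENNReal.ofReal (C2*C1*C3.toReal) = ENNReal.ofReal (C2*C1) * C3 := by
      rw [ENNReal.ofReal_mul (by positivity), ENNReal.ofReal_toReal hC3]
    rw [e1, e2]
    gcongr
    exact SZ_norm_le _ _ (by rw [← ENNReal.ofReal_one]; exact ENNReal.ofReal_le_ofReal hp) _ hf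
  · intro z hz
    obtain ⟨F, hF0, hFd, hFc, hFb⟩ := h1 f hf (i, ⟨z, by simpa using hz⟩)
    have := h2 F (fun s => C1 * SZ (m+1) f (Fin.cons (t i) (fun j => Γ i (s • z) j))) hFd hFc hFb
    simp only [hF0, zero_smul, one_mul] at this
    refine this.trans ?_
    rw [ENNReal.ofReal_mul hC2, mul_assoc]
    refine le_of_eq (congrArg _ ?_)
    rw [← lintegral_const_mul' (ENNReal.ofReal C1) _ ENNReal.ofReal_ne_top]
    refine lintegral_congr fun s => ?_
    rw [ENNReal.ofReal_mul hC1]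
    ring

lemma HB_coord {n : ℕ} (z : HB n) (j : Fin n) : |z.1 j| ≤ 1 :=
  ((PiLp.norm_apply_le z.1 j).trans z.2.le).trans (by norm_num)

lemma cauchy_coord {n : ℕ} (x : EuclideanSpace ℝ (Fin n)) : ∑ i, x i * x i = ‖x‖^2 := by
  rw [EuclideanSpace.real_norm_sq_eq]
  exact Finset.sum_congr rfl fun i _ => by ring

lemma regime_Ia (n m : ℕ) (p : ℝ) (hp : 1 ≤ p) (h : (n:ℝ)/p < m + 1) :
    ∃ C : ℝ, 0 ≤ C ∧ ∀ (t : ℝ) (x : EuclideanSpace ℝ (Fin n)),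
      ∀ f : (Fin (n+1) → ℝ) → ℝ, ContDiff ℝ (⊤:ℕ∞) f →
      ENNReal.ofReal |f (Fin.cons t (fun j => x j))| ≤
        ENNReal.ofReal C * ENNReal.ofReal 1 ^ (1/p) *
          ∑ l ∈ Finset.range (m + 1 + 1), ∑ I : Fin l → VFIdx n,
              sliceNorm (Zpow I f) t (ENNReal.ofReal p) := by
  refine Exists.elim (core n m p hp h (θ := ℝ × EuclideanSpace ℝ (Fin n)) (fun i => i.1)
    (fun i w => i.2 + (1:ℝ) • w) (fun i => by fun_prop) (fun _ => 1)
    (fun i g hg => by simpa using affine_change i.2 1 one_pos g hg)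
    (cf (fun j i _ => i.2.1 j) (fun _ _ => 0) (fun _ _ _ _ => 0) (fun _ _ _ => 0)) ?_ ?_) ?_
  rotate_left 2
  · rintro C ⟨hC, hh⟩
    refine ⟨C, hC, fun t x f hf => ?_⟩
    simpa using hh (t, x) f hf
  · intro f hf i s hs
    rw [cf_sum]
    refine (curve_deriv hf i.1.1 (fun s j => (i.1.2 + (1:ℝ) • s • i.2.1) j) (fun j => i.2.1 j) s
      ?_).congr_deriv ?_
    · intro j
      simp only [PiLp.add_apply, PiLp.smul_apply, smul_eq_mul, one_mul]
      simpa using ((hasDerivAt_id' s).mul_const (i.2.1 j)).const_add (i.1.2 j)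
    · simp
  · intro k
    exact cf_BD (fun j => BD.const k (M := 1) fun i => HB_coord i.2 j) (BD.cst k 0)
      (fun _ _ => BD.cst k 0) (fun _ => BD.cst k 0)

lemma regime_Ib (n m : ℕ) (p : ℝ) (hp : 1 ≤ p) (h : (n:ℝ)/p < m + 1) :
    ∃ C : ℝ, 0 ≤ C ∧ ∀ (t : ℝ) (x : EuclideanSpace ℝ (Fin n)), 0 < t → ‖x‖ ≤ t / 2 →
      ∀ f : (Fin (n+1) → ℝ) → ℝ, ContDiff ℝ (⊤:ℕ∞) f →
      ENNReal.ofReal |f (Fin.cons t (fun j => x j))| ≤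
        ENNReal.ofReal C * ENNReal.ofReal (((t/2)^n)⁻¹) ^ (1/p) *
          ∑ l ∈ Finset.range (m + 1 + 1), ∑ I : Fin l → VFIdx n,
              sliceNorm (Zpow I f) t (ENNReal.ofReal p) := by
  set θ := {q : ℝ × EuclideanSpace ℝ (Fin n) // 0 < q.1 ∧ ‖q.2‖ ≤ q.1 / 2} with hθ
  -- normalized position
  set X : Fin n → (θ × HB n) → ℝ → ℝ := fun j i s => i.1.1.2 j / i.1.1.1 + s * (i.2.1 j / 2) with hX
  set q : (θ × HB n) → ℝ → ℝ := fun i s => 1 - ∑ j, X j i s * X j i s with hq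
  have hXn : ∀ (i : θ × HB n) (s : ℝ), ∑ j, X j i s * X j i s =
      ‖(i.1.1.1)⁻¹ • i.1.1.2 + (s/2) • i.2.1‖^2 := by
    intro i s
    rw [← cauchy_coord]
    refine Finset.sum_congr rfl fun j _ => ?_
    simp only [hX, PiLp.add_apply, PiLp.smul_apply, smul_eq_mul]
    ring
  have hqb : ∀ (i : θ × HB n), ∀ s ∈ Set.Icc (0:ℝ) 1, 7/16 ≤ q i s := by
    intro i s hs
    have ht := i.1.2.1
    have hx := i.1.2.2
    have hz := i.2.2
    have : ‖(i.1.1.1)⁻¹ • i.1.1.2 + (s/2) • i.2.1‖ ≤ 3/4 := by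
      refine (norm_add_le _ _).trans ?_
      rw [norm_smul, norm_smul, Real.norm_eq_abs, Real.norm_eq_abs, abs_of_pos (inv_pos.2 ht),
        abs_of_nonneg (by linarith [hs.1] : 0 ≤ s/2)]
      have e1 : (i.1.1.1)⁻¹ * ‖i.1.1.2‖ ≤ 1/2 := by
        rw [inv_mul_le_iff₀ ht]; linarith
      have e2 : s/2 * ‖i.2.1‖ ≤ 1/2 * (1/2) :=
        mul_le_mul (by linarith [hs.2]) hz.le (norm_nonneg _) (by norm_num)
      linarith
    simp only [hq, hXn]
    nlinarith [norm_nonneg ((i.1.1.1)⁻¹ • i.1.1.2 + (s/2) • i.2.1)]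
  have hzB : ∀ k j, BD k (fun (i : θ × HB n) _ => i.2.1 j) := fun k j =>
    BD.const k (M := 1) fun i => HB_coord i.2 j
  have hXB : ∀ k j, BD k (X j) := by
    intro k j
    refine (BD.const k (a := fun i : θ × HB n => i.1.1.2 j / i.1.1.1) (M := 1) ?_).add
      ((BD.id k).mul (BD.const k (a := fun i : θ × HB n => i.2.1 j / 2) (M := 1) ?_))
    · intro i
      rw [abs_div, abs_of_pos i.1.2.1, div_le_one i.1.2.1]
      have h1 := PiLp.norm_apply_le i.1.1.2 j
      rw [Real.norm_eq_abs] at h1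
      linarith [i.1.2.1, i.1.2.2]
    · intro i
      rw [abs_div]
      have := HB_coord i.2 j
      norm_num
      linarith
  have hqB : ∀ k, BD k q := fun k =>
    (BD.cst k 1).sub (BD.sum _ fun j => (hXB k j).mul (hXB k j))
  have hqi : ∀ k, BD k (fun i s => (q i s)⁻¹) := fun k =>
    (hqB k).inv (m := 7/16) (by norm_num) fun i s hs => (hqb i s hs).trans (le_abs_self _)
  have hhB : ∀ k, BD k (fun i s => (1/2:ℝ) * (q i s)⁻¹) := fun k => (BD.cst k (1/2)).mul (hqi k)
  refine Exists.elim (core n m p hp h (θ := θ) (fun i => i.1.1)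
    (fun i w => i.1.2 + (i.1.1/2) • w) (fun i => by fun_prop) (fun i => ((i.1.1/2)^n)⁻¹)
    (fun i g hg => affine_change i.1.2 _ (by linarith [i.2.1]) g hg)
    (cf (fun _ _ _ => 0)
      (fun i s => -((1/2 * (q i s)⁻¹) * ∑ j, X j i s * i.2.1 j))
      (fun j j' i s => (1/2 * (q i s)⁻¹) * (i.2.1 j * X j' i s - i.2.1 j' * X j i s))
      (fun j i s => (1/2 * (q i s)⁻¹) * i.2.1 j)) ?_ ?_) ?_
  rotate_left 2
  · rintro C ⟨hC, hh⟩
    refine ⟨C, hC, fun t x ht hx f hf => ?_⟩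
    simpa using hh ⟨(t, x), ht, hx⟩ f hf
  · intro f hf i s hs
    rw [cf_sum]
    have ht : 0 < i.1.1.1 := i.1.2.1
    refine (curve_deriv hf i.1.1.1 (fun s j => (i.1.1.2 + (i.1.1.1/2) • s • i.2.1) j)
      (fun j => i.1.1.1/2 * i.2.1 j) s ?_).congr_deriv ?_
    · intro j
      simp only [PiLp.add_apply, PiLp.smul_apply, smul_eq_mul]
      simpa using (((hasDerivAt_id' s).mul_const (i.2.1 j)).const_mul (i.1.1.1/2)).const_add
        (i.1.1.2 j)
    · have hxX : ∀ j, (i.1.1.2 + (i.1.1.1/2) • s • i.2.1) j = i.1.1.1 * X j i s := by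
        intro j
        simp only [hX, PiLp.add_apply, PiLp.smul_apply, smul_eq_mul]
        field_simp
      simp only [hxX]
      set y : Fin (n+1) → ℝ := Fin.cons i.1.1.1 fun j => i.1.1.1 * X j i s
      set T := i.1.1.1
      set D : Fin n → ℝ := fun j => pd j.succ f y with hD
      set D0 := pd 0 f y
      have hrot := rot_sum (fun j => i.2.1 j) (fun j => X j i s) (fun j => T * X j i s) D
      simp only [mul_assoc (1/2 * (q i s)⁻¹)]
      rw [← Finset.mul_sum (s := (Finset.univ : Finset {p : Fin n × Fin n // p.1 < p.2}))]
      rw [hrot]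
      have hqe := hqb i s hs
      have hqn : q i s ≠ 0 := by intro h0; rw [h0] at hqe; norm_num at hqe
      have hX2 : ∑ j, X j i s * X j i s = 1 - q i s := by simp only [hq]; ring
      set zD := ∑ j, i.2.1 j * D j with hzD
      set XD := ∑ j, X j i s * D j with hXD
      set zX := ∑ j, X j i s * i.2.1 j with hzX
      have s1 : ∑ j, T/2 * i.2.1 j * D j = T/2 * zD := by
        rw [hzD, Finset.mul_sum]; exact Finset.sum_congr rfl fun j _ => by ring
      have s2 : ∑ j, T * X j i s * D j = T * XD := by
        rw [hXD, Finset.mul_sum]; exact Finset.sum_congr rfl fun j _ => by ring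
      have s3 : ∑ j, i.2.1 j * (T * X j i s) = T * zX := by
        rw [hzX, Finset.mul_sum]; exact Finset.sum_congr rfl fun j _ => by ring
      have s4 : ∑ j, X j i s * (T * X j i s) = T * (1 - q i s) := by
        rw [← hX2, Finset.mul_sum]; exact Finset.sum_congr rfl fun j _ => by ring
      have s5 : ∑ j, 1/2 * (q i s)⁻¹ * (i.2.1 j * (T * D j + T * X j i s * D0)) =
          1/2 * (q i s)⁻¹ * (T * zD + T * zX * D0) := by
        rw [← Finset.mul_sum, hzD, hzX]
        congr 1
        rw [Finset.mul_sum, Finset.mul_sum, Finset.sum_mul, ← Finset.sum_add_distrib]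
        exact Finset.sum_congr rfl fun j _ => by ring
      have s6 : ∑ j : Fin n, (0:ℝ) * D j = 0 := by simp
      rw [s1, s2, s3, s4, s5, s6]
      field_simp
      ring
  · intro k
    refine cf_BD (fun j => BD.cst k 0) ?_ ?_ ?_
    · exact ((hhB k).mul (BD.sum _ fun j => (hXB k j).mul (hzB k j))).neg
    · exact fun j j' => (hhB k).mul (((hzB k j).mul (hXB k j')).sub ((hzB k j').mul (hXB k j)))
    · exact fun j => (hhB k).mul (hzB k j)

/-- moving direction -/
def vv {n : ℕ} {θ : Type} (ω : θ → EuclideanSpace ℝ (Fin n)) (j : Fin n) (i : θ × HB n) (s : ℝ) : ℝ :=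
  ω i.1 j + s * i.2.1 j

/-- its squared length -/
def vq {n : ℕ} {θ : Type} (ω : θ → EuclideanSpace ℝ (Fin n)) (i : θ × HB n) (s : ℝ) : ℝ :=
  ∑ j, vv ω j i s * vv ω j i s

/-- its product with the velocity -/
def vzz {n : ℕ} {θ : Type} (ω : θ → EuclideanSpace ℝ (Fin n)) (i : θ × HB n) (s : ℝ) : ℝ :=
  ∑ j, vv ω j i s * i.2.1 j

section
variable {n : ℕ} {θ : Type} (ω : θ → EuclideanSpace ℝ (Fin n))

lemma vq_eq (i : θ × HB n) (s : ℝ) : vq ω i s = ‖ω i.1 + s • i.2.1‖^2 := by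
  rw [← cauchy_coord]
  rfl

lemma sqrt_vq (i : θ × HB n) (s : ℝ) : √(vq ω i s) = ‖ω i.1 + s • i.2.1‖ := by
  rw [vq_eq, Real.sqrt_sq (norm_nonneg _)]

lemma sqrt_vq_abs (hω : ∀ i, ‖ω i‖ = 1) (i : θ × HB n) (s : ℝ) (hs : s ∈ Set.Icc (0:ℝ) 1) :
    |√(vq ω i s) - 1| ≤ 1/2 := by
  have h1 := abs_norm_sub_norm_le (ω i.1 + s • i.2.1) (ω i.1)
  rw [hω] at h1
  rw [sqrt_vq]
  refine h1.trans ?_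
  rw [add_sub_cancel_left, norm_smul, Real.norm_eq_abs, abs_of_nonneg hs.1]
  have := i.2.2
  have h0 := norm_nonneg i.2.1
  nlinarith [hs.1, hs.2]

lemma vq_lb (hω : ∀ i, ‖ω i‖ = 1) (i : θ × HB n) (s : ℝ) (hs : s ∈ Set.Icc (0:ℝ) 1) :
    1/4 ≤ vq ω i s := by
  have h := (abs_le.1 (sqrt_vq_abs ω hω i s hs)).1
  rw [sqrt_vq] at h
  rw [vq_eq]
  nlinarith

lemma z_BD (k : ℕ) (j : Fin n) : BD k (fun (i : θ × HB n) _ => i.2.1 j) :=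
  BD.const k (M := 1) fun i => HB_coord i.2 j

lemma vv_BD (hω : ∀ i, ‖ω i‖ = 1) (k : ℕ) (j : Fin n) : BD k (vv ω j) := by
  refine (BD.const k (a := fun i : θ × HB n => ω i.1 j) (M := 1) ?_).add ((BD.id k).mul (z_BD k j))
  intro i
  have := PiLp.norm_apply_le (ω i.1) j
  rw [hω] at this
  exact this

lemma vq_BD (hω : ∀ i, ‖ω i‖ = 1) (k : ℕ) : BD k (vq ω) :=
  BD.sum _ fun j => (vv_BD ω hω k j).mul (vv_BD ω hω k j)

lemma vzz_BD (hω : ∀ i, ‖ω i‖ = 1) (k : ℕ) : BD k (vzz ω) :=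
  BD.sum _ fun j => (vv_BD ω hω k j).mul (z_BD k j)

lemma vqi_BD (hω : ∀ i, ‖ω i‖ = 1) (k : ℕ) : BD k (fun i s => (vq ω i s)⁻¹) :=
  (vq_BD ω hω k).inv (m := 1/4) (by norm_num) fun i s hs => (vq_lb ω hω i s hs).trans (le_abs_self _)

lemma rho_BD (hω : ∀ i, ‖ω i‖ = 1) (k : ℕ) : BD k (fun i s => √(vq ω i s)) :=
  (vq_BD ω hω k).sqrt (m := 1/4) (by norm_num) fun i s hs => vq_lb ω hω i s hs

lemma rhoi_BD (hω : ∀ i, ‖ω i‖ = 1) (k : ℕ) : BD k (fun i s => (√(vq ω i s))⁻¹) :=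
  (rho_BD ω hω k).inv (m := 1/2) (by norm_num) fun i s hs => by
    have h := (abs_le.1 (sqrt_vq_abs ω hω i s hs)).1
    exact le_trans (by linarith) (le_abs_self _)

lemma vv_deriv (j : Fin n) (i : θ × HB n) (s : ℝ) : HasDerivAt (vv ω j i) (i.2.1 j) s := by
  have := ((hasDerivAt_id' s).mul_const (i.2.1 j)).const_add (ω i.1 j)
  rw [one_mul] at this
  exact this

lemma vq_deriv (i : θ × HB n) (s : ℝ) : HasDerivAt (vq ω i) (2 * vzz ω i s) s := by
  have := HasDerivAt.fun_sum (u := Finset.univ) fun j (_ : j ∈ Finset.univ) =>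
    (vv_deriv ω j i s).mul (vv_deriv ω j i s)
  refine this.congr_deriv ?_
  rw [vzz, Finset.mul_sum]
  exact Finset.sum_congr rfl fun j _ => by ring

end

lemma regime_II (n m : ℕ) (hn : 0 < n) (p : ℝ) (hp : 1 ≤ p) (h : (n:ℝ)/p < m + 1) {θ : Type}
    (t r δ : θ → ℝ) (ω : θ → EuclideanSpace ℝ (Fin n)) (hω : ∀ i, ‖ω i‖ = 1)
    (hr : ∀ i, 0 < r i) (hδ : ∀ i, 0 < δ i) (hδr : ∀ i, δ i ≤ r i)
    (E L B : θ × HB n → ℝ → ℝ) (hE : ∀ k, BD k E) (hL : ∀ k, BD k L) (hB : ∀ k, BD k B)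
    (h1 : ∀ i, ∀ s ∈ Set.Icc (0:ℝ) 1, δ i.1 * vzz ω i s * (vq ω i s)⁻¹ = E i s +
      L i s * ((r i.1 + δ i.1 * (√(vq ω i s) - 1)) * (√(vq ω i s))⁻¹) + B i s * t i.1)
    (h2 : ∀ i, ∀ s ∈ Set.Icc (0:ℝ) 1, L i s * t i.1 +
      B i s * ((r i.1 + δ i.1 * (√(vq ω i s) - 1)) * (√(vq ω i s))⁻¹) * vq ω i s = 0) :
    ∃ C : ℝ, 0 ≤ C ∧ ∀ i,
      ∀ f : (Fin (n+1) → ℝ) → ℝ, ContDiff ℝ (⊤:ℕ∞) f →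
      ENNReal.ofReal |f (Fin.cons (t i) (fun j => r i * ω i j))| ≤
        ENNReal.ofReal C * ENNReal.ofReal (3^(n-1) * ((r i)^(n-1))⁻¹ * (δ i)⁻¹) ^ (1/p) *
          ∑ l ∈ Finset.range (m + 1 + 1), ∑ I : Fin l → VFIdx n,
              sliceNorm (Zpow I f) (t i) (ENNReal.ofReal p) := by
  refine Exists.elim (core n m p hp h (θ := θ) t
    (fun i w => ((r i + δ i * (‖ω i + w‖ - 1)) * ‖ω i + w‖⁻¹) • (ω i + w)) (fun i => by fun_prop)
    (fun i => 3^(n-1) * ((r i)^(n-1))⁻¹ * (δ i)⁻¹)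
    (fun i g hg => radial_change hn _ _ (hr i) (hδ i) (hδr i) _ (hω i) g hg)
    (cf (fun j i s => E i s * vv ω j i s) L
      (fun j j' i s => (vq ω i s)⁻¹ * (vv ω j i s * i.2.1 j' - vv ω j' i s * i.2.1 j))
      (fun j i s => B i s * vv ω j i s)) ?_ ?_) ?_
  rotate_left 2
  · rintro C ⟨hC, hh⟩
    refine ⟨C, hC, fun i f hf => ?_⟩
    simpa [hω] using hh i f hf
  · intro f hf i s hs
    rw [cf_sum]
    have hq := vq_lb ω hω i s hs
    have hq0 : vq ω i s ≠ 0 := by intro h0; rw [h0] at hq; norm_num at hq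
    have hρ2 : √(vq ω i s) * √(vq ω i s) = vq ω i s := Real.mul_self_sqrt (by linarith)
    have hρ0 : √(vq ω i s) ≠ 0 := by
      intro h0; rw [h0] at hρ2; simp at hρ2; exact hq0 hρ2.symm
    have hΓ : ∀ s j, (((r i.1 + δ i.1 * (‖ω i.1 + s • i.2.1‖ - 1)) * ‖ω i.1 + s • i.2.1‖⁻¹) •
        (ω i.1 + s • i.2.1)) j = ((r i.1 + δ i.1 * (√(vq ω i s) - 1)) * (√(vq ω i s))⁻¹) *
          vv ω j i s := by
      intro s j
      rw [sqrt_vq]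
      rfl
    simp only [hΓ]
    have h1' := h1 i s hs
    have h2' := h2 i s hs
    have hρd : HasDerivAt (fun s => √(vq ω i s)) (vzz ω i s * (√(vq ω i s))⁻¹) s := by
      refine ((vq_deriv ω i s).sqrt hq0).congr_deriv ?_
      field_simp
    have hgd : HasDerivAt (fun s => (r i.1 + δ i.1 * (√(vq ω i s) - 1)) * (√(vq ω i s))⁻¹)
        (δ i.1 * (vzz ω i s * (√(vq ω i s))⁻¹) * (√(vq ω i s))⁻¹ +
          (r i.1 + δ i.1 * (√(vq ω i s) - 1)) *
            (-(vzz ω i s * (√(vq ω i s))⁻¹) / (√(vq ω i s))^2)) s :=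
      (((hρd.sub_const 1).const_mul (δ i.1)).const_add (r i.1)).mul (hρd.inv hρ0)
    refine (curve_deriv hf (t i.1) (fun s j => ((r i.1 + δ i.1 * (√(vq ω i s) - 1)) *
      (√(vq ω i s))⁻¹) * vv ω j i s) _ s fun j => hgd.mul (vv_deriv ω j i s)).congr_deriv ?_
    set H := r i.1 + δ i.1 * (√(vq ω i s) - 1) with hH
    set y : Fin (n+1) → ℝ := Fin.cons (t i.1) fun j => H * (√(vq ω i s))⁻¹ * vv ω j i s
    set D : Fin n → ℝ := fun j => pd j.succ f y with hD
    set D0 := pd 0 f y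
    have hrot := rot_sum (fun j => vv ω j i s) (fun j => i.2.1 j)
      (fun j => H * (√(vq ω i s))⁻¹ * vv ω j i s) D
    simp only [mul_assoc (vq ω i s)⁻¹]
    rw [← Finset.mul_sum (s := (Finset.univ : Finset {p : Fin n × Fin n // p.1 < p.2}))]
    rw [hrot]
    set zD := ∑ j, i.2.1 j * D j with hzD
    set vD := ∑ j, vv ω j i s * D j with hvD
    set ρ := √(vq ω i s)
    set g := H * ρ⁻¹ with hg
    set vz := vzz ω i s with hvz
    set G := δ i.1 * (vz * ρ⁻¹) * ρ⁻¹ + H * (-(vz * ρ⁻¹) / ρ^2) with hG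
    have s1 : ∑ j, (G * vv ω j i s + g * i.2.1 j) * D j = G * vD + g * zD := by
      rw [hvD, hzD, Finset.mul_sum, Finset.mul_sum, ← Finset.sum_add_distrib]
      exact Finset.sum_congr rfl fun j _ => by ring
    have s2 : ∑ j, E i s * vv ω j i s * D j = E i s * vD := by
      rw [hvD, Finset.mul_sum]; exact Finset.sum_congr rfl fun j _ => by ring
    have s3 : ∑ j, g * vv ω j i s * D j = g * vD := by
      rw [hvD, Finset.mul_sum]; exact Finset.sum_congr rfl fun j _ => by ring
    have s4 : ∑ j, vv ω j i s * (g * vv ω j i s) = g * vq ω i s := by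
      rw [vq, Finset.mul_sum]; exact Finset.sum_congr rfl fun j _ => by ring
    have s5 : ∑ j, i.2.1 j * (g * vv ω j i s) = g * vz := by
      rw [hvz, vzz, Finset.mul_sum]; exact Finset.sum_congr rfl fun j _ => by ring
    have s6 : ∑ j, B i s * vv ω j i s * (t i.1 * D j + g * vv ω j i s * D0) =
        B i s * t i.1 * vD + B i s * g * vq ω i s * D0 := by
      rw [hvD, vq, Finset.mul_sum, Finset.mul_sum, Finset.sum_mul, ← Finset.sum_add_distrib]
      exact Finset.sum_congr rfl fun j _ => by ring
    rw [s1, s2, s3, s4, s5, s6]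
    have hGe : G = δ i.1 * vz * (vq ω i s)⁻¹ - g * vz * (vq ω i s)⁻¹ := by
      rw [hG, hg, ← hρ2]
      field_simp
      ring
    have hc : (vq ω i s)⁻¹ * vq ω i s = 1 := inv_mul_cancel₀ hq0
    rw [hGe]
    linear_combination vD * h1' - D0 * h2' - g * zD * hc
  · intro k
    refine cf_BD (fun j => (hE k).mul (vv_BD ω hω k j)) (hL k) ?_ ?_
    · exact fun j j' => (vqi_BD ω hω k).mul (((vv_BD ω hω k j).mul (z_BD k j')).sub
        ((vv_BD ω hω k j').mul (z_BD k j)))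
    · exact fun j => (hB k).mul (vv_BD ω hω k j)

lemma unit_dir {n : ℕ} (x : EuclideanSpace ℝ (Fin n)) (hx : 0 < ‖x‖) : ‖‖x‖⁻¹ • x‖ = 1 := by
  rw [norm_smul, norm_inv, norm_norm, inv_mul_cancel₀ hx.ne']

lemma unit_dir_mul {n : ℕ} (x : EuclideanSpace ℝ (Fin n)) (hx : 0 < ‖x‖) (j : Fin n) :
    ‖x‖ * (‖x‖⁻¹ • x) j = x j := by
  rw [PiLp.smul_apply, smul_eq_mul, mul_inv_cancel_left₀ hx.ne']

lemma regime_IIa (n m : ℕ) (hn : 0 < n) (p : ℝ) (hp : 1 ≤ p) (h : (n:ℝ)/p < m + 1) :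
    ∃ C : ℝ, 0 ≤ C ∧ ∀ (t : ℝ) (x : EuclideanSpace ℝ (Fin n)), 1 < ‖x‖ →
      ∀ f : (Fin (n+1) → ℝ) → ℝ, ContDiff ℝ (⊤:ℕ∞) f →
      ENNReal.ofReal |f (Fin.cons t (fun j => x j))| ≤
        ENNReal.ofReal C * ENNReal.ofReal (3^(n-1) * (‖x‖^(n-1))⁻¹ * (1/2)⁻¹) ^ (1/p) *
          ∑ l ∈ Finset.range (m + 1 + 1), ∑ I : Fin l → VFIdx n,
              sliceNorm (Zpow I f) t (ENNReal.ofReal p) := by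
  set θ := {q : ℝ × EuclideanSpace ℝ (Fin n) // 1 < ‖q.2‖} with hθ
  set ω : θ → EuclideanSpace ℝ (Fin n) := fun i => ‖i.1.2‖⁻¹ • i.1.2 with hωd
  have hr : ∀ i : θ, 0 < ‖i.1.2‖ := fun i => by linarith [i.2]
  have hω : ∀ i, ‖ω i‖ = 1 := fun i => unit_dir _ (hr i)
  obtain ⟨C, hC, hh⟩ := regime_II n m hn p hp h (θ := θ) (fun i => i.1.1) (fun i => ‖i.1.2‖)
    (fun _ => 1/2) ω hω hr (fun _ => by norm_num) (fun i => by linarith [i.2])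
    (fun i s => 1/2 * vzz ω i s * (vq ω i s)⁻¹) (fun _ _ => 0) (fun _ _ => 0)
    (fun k => ((BD.cst k _).mul (vzz_BD ω hω k)).mul (vqi_BD ω hω k))
    (fun k => BD.cst k 0) (fun k => BD.cst k 0) (fun i s _ => by ring) (fun i s _ => by ring)
  refine ⟨C, hC, fun t x hx f hf => ?_⟩
  have := hh ⟨(t, x), hx⟩ f hf
  simp only [hωd, unit_dir_mul x (by linarith)] at this
  exact this

lemma regime_IIb (n m : ℕ) (hn : 0 < n) (p : ℝ) (hp : 1 ≤ p) (h : (n:ℝ)/p < m + 1) :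
    ∃ C : ℝ, 0 ≤ C ∧ ∀ (t : ℝ) (x : EuclideanSpace ℝ (Fin n)), 0 ≤ t → t / 2 < ‖x‖ →
      1 < |t - ‖x‖| →
      ∀ f : (Fin (n+1) → ℝ) → ℝ, ContDiff ℝ (⊤:ℕ∞) f →
      ENNReal.ofReal |f (Fin.cons t (fun j => x j))| ≤
        ENNReal.ofReal C *
          ENNReal.ofReal (3^(n-1) * (‖x‖^(n-1))⁻¹ * (|t - ‖x‖| / 2)⁻¹) ^ (1/p) *
          ∑ l ∈ Finset.range (m + 1 + 1), ∑ I : Fin l → VFIdx n,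
              sliceNorm (Zpow I f) t (ENNReal.ofReal p) := by
  set θ := {q : ℝ × EuclideanSpace ℝ (Fin n) // 0 ≤ q.1 ∧ q.1 / 2 < ‖q.2‖ ∧ 1 < |q.1 - ‖q.2‖|}
    with hθ
  set ω : θ → EuclideanSpace ℝ (Fin n) := fun i => ‖i.1.2‖⁻¹ • i.1.2 with hωd
  have hr : ∀ i : θ, 0 < ‖i.1.2‖ := fun i => by linarith [i.2.1, i.2.2.1]
  have hω : ∀ i, ‖ω i‖ = 1 := fun i => unit_dir _ (hr i)
  set δ : θ → ℝ := fun i => |i.1.1 - ‖i.1.2‖| / 2 with hδd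
  have hδ : ∀ i, 0 < δ i := fun i => by
    have := i.2.2.2
    simp only [hδd]; linarith
  have hδr : ∀ i, δ i ≤ ‖i.1.2‖ / 2 := fun i => by
    have h1 := i.2.1
    have h2 := i.2.2.1
    have : |i.1.1 - ‖i.1.2‖| ≤ ‖i.1.2‖ := abs_le.2 ⟨by linarith, by linarith⟩
    simp only [hδd]; linarith
  set ε : θ → ℝ := fun i => SignType.sign (i.1.1 - ‖i.1.2‖) with hεd
  have hε : ∀ i, i.1.1 - ‖i.1.2‖ = 2 * ε i * δ i := fun i => by
    have := sign_mul_abs (i.1.1 - ‖i.1.2‖)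
    simp only [hεd, hδd]
    linarith
  have hε1 : ∀ i, |ε i| = 1 := fun i => by
    have h0 := i.2.2.2
    have : i.1.1 - ‖i.1.2‖ ≠ 0 := by intro h1; rw [h1] at h0; norm_num at h0
    rcases lt_or_gt_of_ne this with h1 | h1
    · simp [hεd, sign_neg h1]
    · simp [hεd, sign_pos h1]
  have hsum : ∀ i : θ, 0 < i.1.1 + ‖i.1.2‖ := fun i => by linarith [i.2.1, hr i]
  set T : θ → ℝ := fun i => i.1.1 / (i.1.1 + ‖i.1.2‖) with hTd
  have hT : ∀ i, |T i| ≤ 1 := fun i => by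
    simp only [hTd]
    rw [abs_div, abs_of_nonneg i.2.1, abs_of_pos (hsum i), div_le_one (hsum i)]
    linarith [hr i]
  set Dl : θ → ℝ := fun i => δ i / (i.1.1 + ‖i.1.2‖) with hDd
  have hD : ∀ i, |Dl i| ≤ 1/2 := fun i => by
    simp only [hDd]
    rw [abs_div, abs_of_pos (hδ i), abs_of_pos (hsum i), div_le_iff₀ (hsum i)]
    linarith [hr i, hδr i, i.2.1]
  set κi : θ × HB n → ℝ → ℝ := fun i s => 2 * ε i.1 + (1 - √(vq ω i s)) with hκi
  have hκb : ∀ i, ∀ s ∈ Set.Icc (0:ℝ) 1, 1 ≤ |κi i s| := by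
    intro i s hs
    have h1 := abs_le.1 (sqrt_vq_abs ω hω i s hs)
    rcases (_root_.abs_eq zero_le_one).1 (hε1 i.1) with h2 | h2
    · refine le_trans ?_ (le_abs_self _)
      simp only [hκi, h2]; linarith
    · refine le_trans ?_ (neg_le_abs _)
      simp only [hκi, h2]; linarith
  set τi : θ × HB n → ℝ → ℝ := fun i s => 1 + Dl i.1 * (√(vq ω i s) - 1) with hτi
  have hτb : ∀ i, ∀ s ∈ Set.Icc (0:ℝ) 1, 1/2 ≤ |τi i s| := by
    intro i s hs
    refine le_trans ?_ (le_abs_self _)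
    have h1 : |Dl i.1 * (√(vq ω i s) - 1)| ≤ 1/2 * (1/2) := by
      rw [abs_mul]
      exact mul_le_mul (hD _) (sqrt_vq_abs ω hω i s hs) (abs_nonneg _) (by norm_num)
    have := (abs_le.1 h1).1
    simp only [hτi]; linarith
  have hκB : ∀ k, BD k (fun i s => (κi i s)⁻¹) := fun k => by
    refine BD.inv (m := 1) ?_ (by norm_num) hκb
    refine (BD.const k (a := fun i : θ × HB n => 2 * ε i.1) (M := 2) ?_).add
      ((BD.cst k 1).sub (rho_BD ω hω k))
    intro i
    rw [abs_mul, hε1]; norm_num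
  have hτB : ∀ k, BD k (fun i s => T i.1 * (τi i s)⁻¹) := fun k => by
    refine (BD.const k (a := fun i : θ × HB n => T i.1) (M := 1) fun i => hT _).mul
      (BD.inv (m := 1/2) ?_ (by norm_num) hτb)
    exact (BD.cst k 1).add ((BD.const k (a := fun i : θ × HB n => Dl i.1) (M := 1/2)
      fun i => hD _).mul ((rho_BD ω hω k).sub (BD.cst k 1)))
  have id1 : ∀ i : θ × HB n, ∀ s ∈ Set.Icc (0:ℝ) 1, (κi i s)⁻¹ *
      (i.1.1.1 - (‖i.1.1.2‖ + δ i.1 * (√(vq ω i s) - 1))) = δ i.1 := by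
    intro i s hs
    have h0 : κi i s ≠ 0 := by
      intro h0; have := hκb i s hs; rw [h0] at this; norm_num at this
    rw [inv_mul_eq_iff_eq_mul₀ h0]
    simp only [hκi]
    linear_combination hε i.1
  have id2 : ∀ i : θ × HB n, ∀ s ∈ Set.Icc (0:ℝ) 1, (T i.1 * (τi i s)⁻¹) *
      (i.1.1.1 + (‖i.1.1.2‖ + δ i.1 * (√(vq ω i s) - 1))) = i.1.1.1 := by
    intro i s hs
    have h0 : τi i s ≠ 0 := by
      intro h0; have := hτb i s hs; rw [h0] at this; norm_num at this
    have h3 := (hsum i.1).ne'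
    have e1 : i.1.1.1 + (‖i.1.1.2‖ + δ i.1 * (√(vq ω i s) - 1)) =
        (i.1.1.1 + ‖i.1.1.2‖) * τi i s := by
      simp only [hτi, hDd]
      field_simp
      ring
    rw [e1]
    simp only [hTd]
    field_simp
  obtain ⟨C, hC, hh⟩ := regime_II n m hn p hp h (θ := θ) (fun i => i.1.1) (fun i => ‖i.1.2‖)
    δ ω hω hr hδ (fun i => by linarith [hδr i, hr i])
    (fun _ _ => 0)
    (fun i s => -(vzz ω i s * (√(vq ω i s))⁻¹ * (κi i s)⁻¹ * (1 - T i.1 * (τi i s)⁻¹)))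
    (fun i s => vzz ω i s * (vq ω i s)⁻¹ * (κi i s)⁻¹ * (T i.1 * (τi i s)⁻¹))
    (fun k => BD.cst k 0)
    (fun k => ((((vzz_BD ω hω k).mul (rhoi_BD ω hω k)).mul (hκB k)).mul
      ((BD.cst k 1).sub (hτB k))).neg)
    (fun k => (((vzz_BD ω hω k).mul (vqi_BD ω hω k)).mul (hκB k)).mul (hτB k))
    (fun i s hs => by
      have hq := vq_lb ω hω i s hs
      have hρ2 : (√(vq ω i s))⁻¹ * (√(vq ω i s))⁻¹ = (vq ω i s)⁻¹ := by
        rw [← mul_inv, Real.mul_self_sqrt (by linarith)]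
      have i1 := id1 i s hs
      have i2 := id2 i s hs
      generalize T i.1 * (τi i s)⁻¹ = τ at *
      generalize (κi i s)⁻¹ = κ at *
      generalize ‖i.1.1.2‖ + δ i.1 * (√(vq ω i s) - 1) = H at *
      generalize (√(vq ω i s))⁻¹ = ρi at *
      rw [← hρ2]
      linear_combination (-vzz ω i s * ρi^2) * i1 - vzz ω i s * ρi^2 * κ * i2)
    (fun i s hs => by
      have hq := vq_lb ω hω i s hs
      have hq0 : (vq ω i s)⁻¹ * vq ω i s = 1 := inv_mul_cancel₀ (by linarith)
      have i2 := id2 i s hs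
      generalize T i.1 * (τi i s)⁻¹ = τ at *
      generalize (κi i s)⁻¹ = κ at *
      generalize ‖i.1.1.2‖ + δ i.1 * (√(vq ω i s) - 1) = H at *
      generalize (√(vq ω i s))⁻¹ = ρi at *
      linear_combination vzz ω i s * κ * τ * H * ρi * hq0 + vzz ω i s * κ * ρi * i2)
  refine ⟨C, hC, fun t x h0 hx ht f hf => ?_⟩
  have := hh ⟨(t, x), h0, hx, ht⟩ f hf
  simp only [hωd, unit_dir_mul x (by linarith)] at this
  exact this

lemma weight_bound (n : ℕ) (hn : 0 < n) (p : ℝ) (hp : 1 ≤ p) (C C' K A B a b : ℝ) (hC : 0 ≤ C)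
    (hCC : C ≤ C') (hK : 0 ≤ K) (hA : 0 < A) (hB : 0 < B) (ha : 0 < a) (hb : 0 < b)
    (hAa : A ≤ 4 * a) (hBb : B ≤ 4 * b) (hKK : K ≤ 3^(n-1) * (a^(n-1))⁻¹ * b⁻¹) :
    ENNReal.ofReal C * ENNReal.ofReal K ^ (1/p) ≤
      ENNReal.ofReal (C' * ((3:ℝ)^(n-1) * 4^(n-1) * 4)^(1/p) * A ^ (-((n:ℝ) - 1)/p) *
        B ^ (-(1/p))) := by
  have hp0 : 0 < p := by linarith
  have hip : 0 ≤ 1/p := by positivity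
  have h1 : K ≤ (3^(n-1) * 4^(n-1) * 4) * (A^(n-1))⁻¹ * B⁻¹ := by
    refine hKK.trans ?_
    have e1 : (a^(n-1))⁻¹ ≤ 4^(n-1) * (A^(n-1))⁻¹ := by
      rw [← div_eq_mul_inv, le_div_iff₀ (by positivity), inv_mul_le_iff₀ (by positivity), mul_comm,
        ← mul_pow]
      exact pow_le_pow_left₀ hA.le hAa _
    have e2 : b⁻¹ ≤ 4 * B⁻¹ := by
      rw [← div_eq_mul_inv, le_div_iff₀ (by positivity), inv_mul_le_iff₀ (by positivity)]
      linarith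
    calc (3:ℝ)^(n-1) * (a^(n-1))⁻¹ * b⁻¹ ≤ 3^(n-1) * (4^(n-1) * (A^(n-1))⁻¹) * (4 * B⁻¹) := by
          gcongr
      _ = _ := by ring
  have hn1 : ((n - 1 : ℕ) : ℝ) = (n:ℝ) - 1 := by
    rw [Nat.cast_sub hn]; simp
  have h2 : K ^ (1/p) ≤ ((3:ℝ)^(n-1) * 4^(n-1) * 4)^(1/p) * A ^ (-((n:ℝ) - 1)/p) *
      B ^ (-(1/p)) := by
    refine (Real.rpow_le_rpow hK h1 hip).trans (le_of_eq ?_)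
    rw [Real.mul_rpow (by positivity) (by positivity), Real.mul_rpow (by positivity) (by positivity),
      Real.inv_rpow hB.le, Real.inv_rpow (by positivity), Real.rpow_neg hB.le,
      ← Real.rpow_natCast A, ← Real.rpow_mul hA.le, hn1, ← Real.rpow_neg hA.le]
    congr 3
    ring
  rw [ENNReal.ofReal_rpow_of_nonneg hK hip, ← ENNReal.ofReal_mul hC]
  refine ENNReal.ofReal_le_ofReal ?_
  rw [mul_assoc C', mul_assoc C']
  exact mul_le_mul hCC h2 (by positivity) (hC.trans hCC)

lemma rnorm_eq {n : ℕ} (x : Fin n → ℝ) : rnorm x = ‖(WithLp.toLp 2 x : EuclideanSpace ℝ (Fin n))‖ := by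
  rw [EuclideanSpace.norm_eq, rnorm]
  simp

lemma zero_case (N : ℕ) (p : ℝ) (hp1 : 1 ≤ p) (φ : (Fin (0+1) → ℝ) → ℝ) (y : Fin (0+1) → ℝ)
    (hy : 0 ≤ y 0) :
    ENNReal.ofReal |φ y| ≤
      ENNReal.ofReal (1 * (1 + y 0 + rnorm (Fin.tail y)) ^ (-(((0:ℕ):ℝ) - 1)/p) *
          (1 + |y 0 - rnorm (Fin.tail y)|) ^ (-(1/p))) *
        ∑ l ∈ Finset.range (N + 1), ∑ I : Fin l → VFIdx 0,
          sliceNorm (Zpow I φ) (y 0) (ENNReal.ofReal p) := by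
  have hr : rnorm (Fin.tail y) = 0 := by simp [rnorm]
  have hw : (1 * (1 + y 0 + rnorm (Fin.tail y)) ^ (-(((0:ℕ):ℝ) - 1)/p) *
          (1 + |y 0 - rnorm (Fin.tail y)|) ^ (-(1/p))) = 1 := by
    rw [hr, sub_zero, abs_of_nonneg hy, add_zero, one_mul, ← Real.rpow_add (by linarith)]
    have : (-(((0:ℕ):ℝ) - 1)/p) + -(1/p) = 0 := by push_cast; ring
    rw [this, Real.rpow_zero]
  rw [hw, ENNReal.ofReal_one, one_mul]
  have h0 : ENNReal.ofReal |φ y| ≤ ∑ I : Fin 0 → VFIdx 0,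
      sliceNorm (Zpow I φ) (y 0) (ENNReal.ofReal p) := by
    have hy' : ∀ x : Fin 0 → ℝ, (Fin.cons (y 0) x : Fin (0+1) → ℝ) = y := by
      intro x
      funext j
      have : j = 0 := by fin_cases j; rfl
      subst this
      rfl
    have hp' : ENNReal.ofReal p ≠ 0 := by simpa using (by linarith : 0 < p)
    rw [Fintype.sum_unique]
    simp only [sliceNorm, Zpow, List.ofFn_zero, List.foldr_nil, hy']
    rw [Measure.volume_pi_eq_dirac (fun _ => (0:ℝ)), eLpNorm_const _ hp' (by
      intro h; simpa using congrArg (fun μ => μ Set.univ) h)]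
    simp [← ofReal_norm]
  refine h0.trans ?_
  exact Finset.single_le_sum (f := fun l => ∑ I : Fin l → VFIdx 0,
    sliceNorm (Zpow I φ) (y 0) (ENNReal.ofReal p)) (fun _ _ => zero_le) (by simp)

/-- The Klainerman–Sobolev inequality: for `p ∈ [1,∞)` and an integer `N > n/p`,
`|φ(t,x)| ≤ C (1+t+|x|)^{−(n−1)/p} (1+|t−|x||)^{−1/p} Σ_{|I|≤N} ‖Z^I φ(t,·)‖_{L^p}`. -/
theorem stmt_16 (n N : ℕ) (p : ℝ) (hp1 : 1 ≤ p) (hpN : (n : ℝ)/p < N) :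
    ∃ C : ℝ, 0 < C ∧ ∀ φ : (Fin (n+1) → ℝ) → ℝ, ContDiff ℝ (⊤:ℕ∞) φ →
      ∀ y : Fin (n+1) → ℝ, 0 ≤ y 0 →
        ENNReal.ofReal |φ y| ≤
          ENNReal.ofReal (C * (1 + y 0 + rnorm (Fin.tail y)) ^ (-((n:ℝ) - 1)/p) *
              (1 + |y 0 - rnorm (Fin.tail y)|) ^ (-(1/p))) *
            ∑ l ∈ Finset.range (N + 1), ∑ I : Fin l → VFIdx n,
              sliceNorm (Zpow I φ) (y 0) (ENNReal.ofReal p) := by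
  rcases Nat.eq_zero_or_pos n with rfl | hn
  · exact ⟨1, one_pos, fun φ _ y hy => zero_case N p hp1 φ y hy⟩
  have hp0 : 0 < p := by linarith
  obtain ⟨m, rfl⟩ : ∃ m, N = m + 1 := by
    refine Nat.exists_eq_succ_of_ne_zero ?_
    rintro rfl
    have : (0:ℝ) ≤ (n:ℝ)/p := by positivity
    simp only [Nat.cast_zero] at hpN
    linarith
  have h : (n:ℝ)/p < m + 1 := by exact_mod_cast hpN
  obtain ⟨C1, hC1, h1⟩ := regime_Ia n m p hp1 h
  obtain ⟨C2, hC2, h2⟩ := regime_Ib n m p hp1 h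
  obtain ⟨C3, hC3, h3⟩ := regime_IIa n m hn p hp1 h
  obtain ⟨C4, hC4, h4⟩ := regime_IIb n m hn p hp1 h
  refine ⟨(C1 + C2 + C3 + C4 + 1) * ((3:ℝ)^(n-1) * 4^(n-1) * 4)^(1/p), by positivity,
    fun φ hφ y hy => ?_⟩
  rw [rnorm_eq]
  set x : EuclideanSpace ℝ (Fin n) := WithLp.toLp 2 (Fin.tail y) with hx
  have hyx : y = Fin.cons (y 0) (fun j => x j) := (Fin.cons_self_tail y).symm
  set t := y 0 with ht
  have hr := norm_nonneg x
  set r := ‖x‖ with hrd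
  have hab : |t - r| ≤ t + r := abs_le.2 ⟨by linarith, by linarith⟩
  have hA : 0 < 1 + t + r := by linarith
  have hB : 0 < 1 + |t - r| := by linarith [abs_nonneg (t - r)]
  have h31 : (1:ℝ) ≤ 3^(n-1) := one_le_pow₀ (by norm_num)
  rw [hyx]
  by_cases hII : t / 2 < r ∧ 1 < r
  · by_cases hc : 1 < |t - r|
    · refine (h4 t x hy hII.1 hc φ hφ).trans (mul_le_mul_left ?_ _)
      exact weight_bound n hn p hp1 _ _ _ _ _ r (|t - r|/2) hC4 (by linarith) (by positivity) hA hB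
        (by linarith) (by linarith) (by linarith) (by linarith) le_rfl
    · refine (h3 t x hII.2 φ hφ).trans (mul_le_mul_left ?_ _)
      exact weight_bound n hn p hp1 _ _ _ _ _ r (1/2) hC3 (by linarith) (by positivity) hA hB
        (by linarith) (by linarith) (by linarith) (by linarith) le_rfl
  · by_cases ht2 : t ≤ 2
    · have hr1 : r ≤ 1 := by
        by_contra hcon
        exact hII ⟨by linarith, by linarith⟩
      have hab2 : |t - r| ≤ 2 := abs_le.2 ⟨by linarith, by linarith⟩
      refine (h1 t x φ hφ).trans (mul_le_mul_left ?_ _)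
      exact weight_bound n hn p hp1 _ _ _ _ _ 1 1 hC1 (by linarith) (by positivity) hA hB
        (by linarith) (by linarith) (by linarith) (by linarith) (by simpa using h31)
    · have hr1 : r ≤ t/2 := by
        by_contra hcon
        exact hII ⟨by linarith, by linarith⟩
      refine (h2 t x (by linarith) hr1 φ hφ).trans (mul_le_mul_left ?_ _)
      have ht0 : 0 < t / 2 := by linarith
      refine weight_bound n hn p hp1 _ _ _ _ _ (t/2) (t/2) hC2 (by linarith) (by positivity) hA hB
        ht0 ht0 (by linarith) (by linarith) ?_
      have : ((t/2)^n)⁻¹ = 1 * ((t/2)^(n-1))⁻¹ * (t/2)⁻¹ := by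
        rw [one_mul, ← mul_inv, ← pow_succ, Nat.sub_add_cancel hn]
      rw [this]
      gcongr
end
end

section
/- Suppose φ₀ ∈ C^∞(ℝ²) satisfies |φ₀(y)| ≤ A(1+|y|)^{−k} for all y ∈ ℝ², where A > 0 and k > 1. Then there is a constant C such that for all t > 0 and all x ∈ ℝ² with |x| ≥ t, |(1/(2πt)) ∫_{|x−y| ≤ t} φ₀(y)(t² − |y−x|²)^{−1/2} dy| ≤ CA / (√(1+t+|x|) · (1+|x|−t)^{k−1/2}). -/
open MeasureTheory Real NNReal ENNReal

noncomputable section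

open Set in
lemma w_radial : ∃ c : ℝ, 0 ≤ c ∧ ∀ (R : ℝ) (g G : ℝ → ℝ), 0 ≤ R →
    ContinuousOn G (Icc 0 R) → (∀ s ∈ Ioo 0 R, HasDerivAt G (s * g s) s) →
    (∀ s ∈ Ioo 0 R, 0 ≤ g s) →
    Integrable (fun y : Fin 2 → ℝ => (Iic R).indicator g (rnorm y)) ∧
    ∫ y : Fin 2 → ℝ, (Iic R).indicator g (rnorm y) = c * (G R - G 0) := by
  refine ⟨2 * (volume : Measure (EuclideanSpace ℝ (Fin 2))).real (Metric.ball 0 1), by positivity, ?_⟩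
  intro R g G hR hc hd hp
  have hio : IntegrableOn (fun s => s * g s) (Ioc 0 R) :=
    intervalIntegral.integrableOn_deriv_of_nonneg hc hd
      (fun s hs => mul_nonneg hs.1.le (hp s hs))
  have hint : ∫ s in (0:ℝ)..R, s * g s = G R - G 0 :=
    intervalIntegral.integral_eq_sub_of_hasDerivAt_of_le hR hc hd
      ((intervalIntegrable_iff_integrableOn_Ioc_of_le hR).2 hio)
  have hn : ∀ y : Fin 2 → ℝ, rnorm y = ‖WithLp.toLp 2 y‖ := by
    intro y
    rw [EuclideanSpace.norm_eq]
    simp [rnorm]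
  have hfe : (fun s : ℝ => s ^ (Module.finrank ℝ (EuclideanSpace ℝ (Fin 2)) - 1) •
      (Iic R).indicator g s) = (Iic R).indicator (fun s => s * g s) := by
    funext s
    by_cases h : s ∈ Iic R <;> simp [h, indicator]
  have hmp := PiLp.volume_preserving_toLp (Fin 2)
  have hemb : MeasurableEmbedding (WithLp.toLp 2 : (Fin 2 → ℝ) → EuclideanSpace ℝ (Fin 2)) :=
    (MeasurableEquiv.toLp 2 (Fin 2 → ℝ)).measurableEmbedding
  constructor
  · have h1 := (integrable_fun_norm_addHaar (volume : Measure (EuclideanSpace ℝ (Fin 2)))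
      (f := (Iic R).indicator g)).2 (by
        rw [hfe, IntegrableOn, integrable_indicator_iff measurableSet_Iic, IntegrableOn,
          Measure.restrict_restrict measurableSet_Iic, inter_comm, Ioi_inter_Iic]
        exact hio)
    have := (hmp.integrable_comp_emb hemb).2 h1
    simpa [Function.comp_def, hn] using this
  · have h1 := integral_fun_norm_addHaar (volume : Measure (EuclideanSpace ℝ (Fin 2)))
      ((Iic R).indicator g)
    rw [hfe, integral_indicator measurableSet_Iic,
      Measure.restrict_restrict measurableSet_Iic, inter_comm, Ioi_inter_Iic,
      ← intervalIntegral.integral_of_le hR, hint] at h1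
    have := hmp.integral_comp hemb (fun x => (Iic R).indicator g ‖x‖)
    simp only [hn]
    rw [this, h1]
    simp [mul_assoc]

open Set in
lemma w_ker (c : ℝ) (hc : ∀ (R : ℝ) (g G : ℝ → ℝ), 0 ≤ R →
    ContinuousOn G (Icc 0 R) → (∀ s ∈ Ioo 0 R, HasDerivAt G (s * g s) s) →
    (∀ s ∈ Ioo 0 R, 0 ≤ g s) →
    Integrable (fun y : Fin 2 → ℝ => (Iic R).indicator g (rnorm y)) ∧
    ∫ y : Fin 2 → ℝ, (Iic R).indicator g (rnorm y) = c * (G R - G 0))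
    (p t : ℝ) (hp1 : p < 1) (ht : 0 < t) (x : Fin 2 → ℝ) :
    Integrable (fun y : Fin 2 → ℝ =>
      (Iic t).indicator (fun s => (t^2 - s^2) ^ (-p)) (rnorm (y - x))) ∧
    ∫ y : Fin 2 → ℝ, (Iic t).indicator (fun s => (t^2 - s^2) ^ (-p)) (rnorm (y - x))
      = c * ((t^2) ^ (1-p) / (2 * (1 - p))) := by
  have h := hc t (fun s => (t^2 - s^2) ^ (-p)) (fun s => - ((t^2 - s^2) ^ (1-p) / (2 * (1 - p))))
    ht.le
    (by
      apply ContinuousOn.neg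
      apply ContinuousOn.div_const
      apply ContinuousOn.rpow_const (by fun_prop)
      intro s hs
      right; linarith)
    (by
      intro s hs
      have hpos : 0 < t^2 - s^2 := by nlinarith [hs.1, hs.2]
      have h1 : HasDerivAt (fun s : ℝ => t^2 - s^2) (-(2 * s)) s := by
        simpa using ((hasDerivAt_pow 2 s).const_sub (t^2))
      have h2 := ((h1.rpow_const (p := 1 - p) (Or.inl hpos.ne')).div_const (2 * (1-p))).neg
      refine h2.congr_deriv ?_
      have : 1 - p ≠ 0 := by linarith
      rw [show 1 - p - 1 = -p by ring]
      field_simp)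
    (by
      intro s hs
      have hpos : 0 < t^2 - s^2 := by nlinarith [hs.1, hs.2]
      positivity)
  refine ⟨h.1.comp_sub_right x, ?_⟩
  rw [integral_sub_right_eq_self
    (fun y => (Iic t).indicator (fun s => (t^2 - s^2) ^ (-p)) (rnorm y)) x, h.2]
  have : (1 - p) ≠ 0 := by linarith
  simp [Real.zero_rpow this]

open Set in
lemma w_pot (c : ℝ) (hc : ∀ (R : ℝ) (g G : ℝ → ℝ), 0 ≤ R →
    ContinuousOn G (Icc 0 R) → (∀ s ∈ Ioo 0 R, HasDerivAt G (s * g s) s) →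
    (∀ s ∈ Ioo 0 R, 0 ≤ g s) →
    Integrable (fun y : Fin 2 → ℝ => (Iic R).indicator g (rnorm y)) ∧
    ∫ y : Fin 2 → ℝ, (Iic R).indicator g (rnorm y) = c * (G R - G 0))
    (t : ℝ) (ht : 0 < t) :
    Integrable (fun y : Fin 2 → ℝ =>
      (Iic t).indicator (fun s => s ^ (-(3/2) : ℝ)) (rnorm y)) ∧
    ∫ y : Fin 2 → ℝ, (Iic t).indicator (fun s => s ^ (-(3/2):ℝ)) (rnorm y)
      = c * (2 * t ^ (1/2 : ℝ)) := by
  have h := hc t (fun s => s ^ (-(3/2):ℝ)) (fun s => 2 * s ^ (1/2 : ℝ))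
    ht.le
    (by
      apply ContinuousOn.mul (by fun_prop)
      apply ContinuousOn.rpow_const (by fun_prop)
      intro s hs
      right; norm_num)
    (by
      intro s hs
      have h2 := (Real.hasDerivAt_rpow_const (x := s) (p := 1/2) (Or.inl hs.1.ne')).const_mul 2
      refine h2.congr_deriv ?_
      have h3 : s ^ (1/2 - 1 : ℝ) = s ^ (1:ℝ) * s ^ (-(3/2):ℝ) := by
        rw [← Real.rpow_add hs.1]; norm_num
      rw [h3, Real.rpow_one]; ring)
    (by
      intro s hs
      have := hs.1
      positivity)
  refine ⟨h.1, ?_⟩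
  rw [h.2]
  simp

lemma w_rn_eq (y : Fin 2 → ℝ) : rnorm y = ‖WithLp.toLp 2 y‖ := by
  rw [EuclideanSpace.norm_eq]
  simp [rnorm]

lemma w_rn_add (x y : Fin 2 → ℝ) : rnorm (x + y) ≤ rnorm x + rnorm y := by
  simp only [w_rn_eq, WithLp.toLp_add]
  exact norm_add_le _ _

lemma w_rn_sub_comm (x y : Fin 2 → ℝ) : rnorm (x - y) = rnorm (y - x) := by
  simp only [w_rn_eq, WithLp.toLp_sub]
  exact norm_sub_rev _ _

lemma w_rn_meas (x : Fin 2 → ℝ) (t : ℝ) : MeasurableSet {y : Fin 2 → ℝ | rnorm (x - y) ≤ t} := by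
  apply IsClosed.measurableSet
  apply isClosed_le _ continuous_const
  unfold rnorm
  fun_prop

lemma w_rn_nonneg (x : Fin 2 → ℝ) : 0 ≤ rnorm x := Real.sqrt_nonneg _

lemma w_rn_pos (x : Fin 2 → ℝ) (h : x ≠ 0) : 0 < rnorm x := by
  rw [w_rn_eq]; simpa using h

lemma w_young {a b : ℝ} (ha : 0 ≤ a) (hb : 0 ≤ b) : a * b ≤ a ^ (3:ℝ) + b ^ (3/2:ℝ) := by
  have h := Real.young_inequality_of_nonneg ha hb (p := 3) (q := 3/2)
    (by rw [Real.holderConjugate_iff]; norm_num)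
  have h1 : 0 ≤ a ^ (3:ℝ) := by positivity
  have h2 : 0 ≤ b ^ (3/2:ℝ) := by positivity
  linarith

open Set in
/-- generic bound: integral over the disc of a dominated function -/
lemma w_dom (S : Set (Fin 2 → ℝ)) (hS : MeasurableSet S) (f g : (Fin 2 → ℝ) → ℝ)
    (hg : Integrable g) (hg0 : ∀ y, 0 ≤ g y) (h : ∀ y ∈ S, y ≠ 0 → |f y| ≤ g y) :
    |∫ y in S, f y| ≤ ∫ y, g y := by
  have hne : ∀ᵐ y : Fin 2 → ℝ, y ≠ 0 := compl_mem_ae_iff.mpr (measure_singleton 0)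
  have h1 : ‖∫ y in S, f y‖ ≤ ∫ y in S, g y := by
    apply norm_integral_le_of_norm_le hg.integrableOn
    filter_upwards [ae_restrict_mem hS, ae_restrict_of_ae hne] with y hy hy0
    exact h y hy hy0
  refine h1.trans (setIntegral_le_integral hg (Filter.Eventually.of_forall hg0))

/-- Estimate of the first term of the Poisson formula for the 2D wave equation,
exterior region `|x| ≥ t`, with slowly decaying data `|φ₀| ≤ A(1+|·|)^{−k}`, `k > 1`. -/
theorem stmt_17 (A k : ℝ) (hA : 0 < A) (hk : 1 < k)
    (φ₀ : (Fin 2 → ℝ) → ℝ) (hs : ContDiff ℝ (⊤:ℕ∞) φ₀)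
    (hd : ∀ y, |φ₀ y| ≤ A / (1 + rnorm y) ^ k) :
    ∃ C : ℝ, 0 < C ∧ ∀ t : ℝ, 0 < t → ∀ x : Fin 2 → ℝ, t ≤ rnorm x →
      |(1 / (2 * Real.pi * t)) *
          ∫ y in {y : Fin 2 → ℝ | rnorm (x - y) ≤ t},
            φ₀ y / Real.sqrt (t^2 - rnorm (y - x) ^ 2)| ≤
        C * A / (Real.sqrt (1 + t + rnorm x) * (1 + rnorm x - t) ^ (k - 1/2)) := by
  obtain ⟨c, hc0, hc⟩ := w_radial
  refine ⟨12 * c + 1, by positivity, ?_⟩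
  intro t ht x hx
  set r := rnorm x with hr
  set δ := 1 + r - t with hδ
  have hδ1 : 1 ≤ δ := by linarith
  have hδ0 : 0 < δ := by linarith
  have hS := w_rn_meas x t
  have hlow : ∀ y, rnorm (x - y) ≤ t → δ ≤ 1 + rnorm y := by
    intro y hy
    have := w_rn_add (x - y) y
    rw [sub_add_cancel] at this
    linarith
  have hpi : 1 / (2 * π * t) ≤ 1 / t * (1/2) := by
    rw [div_mul_div_comm, mul_one]
    apply one_div_le_one_div_of_le (by positivity)
    nlinarith [Real.pi_gt_three]
  have hD : 0 < δ ^ (k - 1/2) := by positivity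
  have hT : 0 < √(1 + t + r) := Real.sqrt_pos.2 (by linarith)
  -- reduction
  suffices hmain : ∃ B : ℝ, |∫ y in {y : Fin 2 → ℝ | rnorm (x - y) ≤ t},
            φ₀ y / Real.sqrt (t^2 - rnorm (y - x) ^ 2)| ≤ A * B / δ ^ (k - 1/2) ∧
            B * √(1 + t + r) ≤ 24 * c * t by
    obtain ⟨B, hB1, hB2⟩ := hmain
    rw [abs_mul, abs_of_pos (by positivity)]
    calc _ ≤ 1 / t * (1/2) * (A * B / δ ^ (k - 1/2)) := by
          gcongr
      _ = A / (√(1 + t + r) * δ ^ (k - 1/2)) * ((B * √(1 + t + r)) / (2 * t)) := by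
          field_simp
      _ ≤ A / (√(1 + t + r) * δ ^ (k - 1/2)) * (12 * c + 1) := by
          gcongr
          rw [div_le_iff₀ (by positivity)]
          linarith
      _ = _ := by ring
  have hsq : ∀ z : ℝ, 0 ≤ z → 1 / √z = z ^ (-(1/2) : ℝ) := by
    intro z hz
    rw [Real.sqrt_eq_rpow, Real.rpow_neg hz, one_div]
  have hφ : ∀ y, |φ₀ y / Real.sqrt (t^2 - rnorm (y - x) ^ 2)| ≤
      A / (1 + rnorm y) ^ k * (1 / Real.sqrt (t^2 - rnorm (y - x) ^ 2)) := by
    intro y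
    rw [abs_div, abs_of_nonneg (Real.sqrt_nonneg _), div_eq_mul_one_div]
    gcongr
    exact hd y
  have hmem : ∀ y, rnorm (x - y) ≤ t → rnorm (y - x) ≤ t ∧ 0 ≤ t^2 - rnorm (y-x)^2 := by
    intro y hy
    rw [w_rn_sub_comm] at hy
    refine ⟨hy, ?_⟩
    nlinarith [w_rn_nonneg (y - x)]
  have hind : ∀ (p : ℝ) y, 0 ≤ (Set.Iic t).indicator (fun s => (t^2 - s^2) ^ (-p)) (rnorm (y - x)) := by
    intro p y
    apply Set.indicator_apply_nonneg
    intro h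
    have : 0 ≤ t^2 - rnorm (y-x)^2 := by
      have := w_rn_nonneg (y - x)
      simp only [Set.mem_Iic] at h
      nlinarith
    positivity
  by_cases hcase : 2 * t ≤ r + 1
  · -- far region
    obtain ⟨hi, hv⟩ := w_ker c hc (1/2) t (by norm_num) ht x
    refine ⟨c * t / √δ, ?_, ?_⟩
    · have := w_dom _ hS (fun y => φ₀ y / Real.sqrt (t^2 - rnorm (y - x) ^ 2)) _
        (hi.const_mul (A / δ ^ k)) (fun y => mul_nonneg (by positivity) (hind _ y)) (by
          intro y hy _
          refine (hφ y).trans ?_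
          obtain ⟨h1, h2⟩ := hmem y hy
          rw [Set.indicator_of_mem (by exact h1), hsq _ h2]
          gcongr
          exact hlow y hy)
      refine this.trans (le_of_eq ?_)
      rw [integral_const_mul, hv]
      have e1 : (t^2) ^ (1 - 1/2 : ℝ) = t := by
        rw [show (1 - 1/2 : ℝ) = 1/2 by norm_num, ← Real.sqrt_eq_rpow, Real.sqrt_sq ht.le]
      have e2 : δ ^ k = √δ * δ ^ (k - 1/2) := by
        rw [Real.sqrt_eq_rpow, ← Real.rpow_add hδ0]; ring_nf
      rw [e1, e2]
      field_simp
      norm_num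
    · have h3 : √(1 + t + r) ≤ 2 * √δ := by
        rw [Real.sqrt_le_left (by positivity), mul_pow, Real.sq_sqrt hδ0.le]
        linarith
      have : 0 < √δ := Real.sqrt_pos.2 hδ0
      calc _ ≤ c * t / √δ * (2 * √δ) := by gcongr
        _ = 2 * (c * t) := by field_simp
        _ ≤ _ := by nlinarith [mul_nonneg hc0 ht.le]
  · -- near region
    push Not at hcase
    obtain ⟨hi, hv⟩ := w_ker c hc (3/4) t (by norm_num) ht x
    obtain ⟨hi', hv'⟩ := w_pot c hc (4 * t) (by positivity)
    refine ⟨c * (6 * √t), ?_, ?_⟩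
    · have := w_dom _ hS (fun y => φ₀ y / Real.sqrt (t^2 - rnorm (y - x) ^ 2)) _
        ((hi'.add hi).const_mul (A / δ ^ (k - 1/2)))
        (fun y => mul_nonneg (by positivity) (add_nonneg (Set.indicator_apply_nonneg
          (fun _ => Real.rpow_nonneg (w_rn_nonneg _) _)) (hind _ y))) (by
          intro y hy hy0
          refine (hφ y).trans ?_
          obtain ⟨h1, h2⟩ := hmem y hy
          have h4 : rnorm y ≤ 4 * t := by
            have := w_rn_add (y - x) x
            rw [sub_add_cancel] at this
            linarith
          have hyp := w_rn_pos y hy0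
          simp only [Pi.add_apply]
          rw [Set.indicator_of_mem (by exact h4), Set.indicator_of_mem (by exact h1), hsq _ h2]
          have e2 : (1 + rnorm y) ^ k = (1 + rnorm y) ^ (k - 1/2) * (1 + rnorm y) ^ (1/2 : ℝ) := by
            rw [← Real.rpow_add (by linarith)]; ring_nf
          have hy5 := w_young (a := rnorm y ^ (-(1/2) : ℝ))
            (b := (t^2 - rnorm (y - x)^2) ^ (-(1/2) : ℝ)) (by positivity) (by positivity)
          rw [← Real.rpow_mul hyp.le, ← Real.rpow_mul h2] at hy5
          norm_num at hy5
          have hl := hlow y hy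
          calc A / (1 + rnorm y) ^ k * (t^2 - rnorm (y - x)^2) ^ (-(1/2) : ℝ)
              = A / (1 + rnorm y) ^ (k - 1/2) * ((1 / (1 + rnorm y) ^ (1/2 : ℝ)) *
                (t^2 - rnorm (y - x)^2) ^ (-(1/2) : ℝ)) := by
                rw [e2]; field_simp
            _ ≤ A / δ ^ (k - 1/2) * ((1 / (rnorm y) ^ (1/2 : ℝ)) *
                (t^2 - rnorm (y - x)^2) ^ (-(1/2) : ℝ)) := by
                gcongr
                · linarith
                · linarith
            _ = A / δ ^ (k - 1/2) * ((rnorm y) ^ (-(1/2) : ℝ) *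
                (t^2 - rnorm (y - x)^2) ^ (-(1/2) : ℝ)) := by
                rw [Real.rpow_neg hyp.le, one_div ((rnorm y) ^ (1/2 : ℝ))]
            _ ≤ _ := by
                gcongr)
      refine this.trans (le_of_eq ?_)
      rw [integral_const_mul]
      simp only [Pi.add_apply]
      rw [integral_add hi' hi, hv, hv']
      have e1 : (t^2) ^ (1 - 3/4 : ℝ) = √t := by
        rw [Real.sqrt_eq_rpow, ← Real.rpow_natCast, ← Real.rpow_mul ht.le]
        norm_num
      have e2 : (4 * t) ^ (1/2 : ℝ) = 2 * √t := by
        rw [← Real.sqrt_eq_rpow, Real.sqrt_mul (by norm_num), show (4:ℝ) = 2^2 by norm_num,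
          Real.sqrt_sq (by norm_num)]
      rw [e1, e2]
      ring
    · have h3 : √(1 + t + r) ≤ 2 * √t := by
        rw [Real.sqrt_le_left (by positivity), mul_pow, Real.sq_sqrt ht.le]
        linarith
      calc _ ≤ c * (6 * √t) * (2 * √t) := by gcongr
        _ = 12 * (c * (√t * √t)) := by ring
        _ = 12 * (c * t) := by rw [Real.mul_self_sqrt ht.le]
        _ ≤ _ := by nlinarith [mul_nonneg hc0 ht.le]
end
end
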